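/- arXiv:0904.1129 — 4 statements merged into one kernel-verified Lean document; each statement's English description precedes it below -/
import Mathlib

section
/- Let (p,q) be Schrödinger-admissible with (p,q) ≠ (∞,2). Then there is no constant C > 0 with the following property: for every T > 0 and every smooth function u : [0,T]×ℝⁿ → ℂ whose support in the space variable is contained in a fixed compact subset of ℝⁿ∖{0}, one has ‖u‖_{L^p((0,T);L^q(ℝⁿ))} ≤ C(‖u(0,·)‖_{L²(ℝⁿ)} + ‖i∂_t u − Δu + 2iA·∇u + |A|²u‖_{L^{p'}((0,T);L^{q'}(ℝⁿ))}). In other words, solutions of the inhomogeneous magnetic Schrödinger equation i∂_t u + Hu = F with H = −(∇−iA)² = −Δ + 2iA·∇ + |A|² (A is divergence free) and magnetic potential A(x) = |x|^{−α}Mx, 1 < α < 2, cannot satisfy the Strichartz estimates. -/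
open MeasureTheory Filter

noncomputable section

/-- Euclidean norm on `Fin m → ℝ`. -/
def euclNorm {m : ℕ} (y : Fin m → ℝ) : ℝ := Real.sqrt (∑ i, y i ^ 2)

/-- For even `m`, the `m × m` block-diagonal matrix with `m/2` diagonal blocks
`σ = ![![0,1],![-1,0]]`. -/
def omegaMat (m : ℕ) : Matrix (Fin m) (Fin m) ℝ := fun i j =>
  if i.val % 2 = 0 ∧ j.val = i.val + 1 then 1
  else if j.val % 2 = 0 ∧ i.val = j.val + 1 then -1
  else 0

/-- The `n × n` matrix whose upper-left `k × k` block is `Ω_k` and whose remaining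
entries vanish. -/
def Mmat (n k : ℕ) : Matrix (Fin n) (Fin n) ℝ := fun i j =>
  if i.val < k ∧ j.val < k then
    (if i.val % 2 = 0 ∧ j.val = i.val + 1 then 1
     else if j.val % 2 = 0 ∧ i.val = j.val + 1 then -1
     else 0)
  else 0

/-- `i`-th partial derivative of a function on `Fin m → ℝ`. -/
def pd {m : ℕ} (f : (Fin m → ℝ) → ℂ) (i : Fin m) (y : Fin m → ℝ) : ℂ :=
  fderiv ℝ f y (Pi.single i 1)

/-- Laplacian on `Fin m → ℝ`. -/
def lapV {m : ℕ} (f : (Fin m → ℝ) → ℂ) (y : Fin m → ℝ) : ℂ :=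
  ∑ i, pd (pd f i) i y

/-- Twisted Laplacian (Landau Hamiltonian)
`T v = -Δv + 2i (Ω_m y)·∇v + |y|² v` on `Fin m → ℝ`. -/
def twistedLap (m : ℕ) (f : (Fin m → ℝ) → ℂ) (y : Fin m → ℝ) : ℂ :=
  - lapV f y + 2 * Complex.I * ∑ i, (((omegaMat m).mulVec y i : ℝ) : ℂ) * pd f i y
    + ((euclNorm y ^ 2 : ℝ) : ℂ) * f y

/-- `L^q` norm (with real exponent) of a complex-valued function. -/
def LqNorm {X : Type*} [MeasureSpace X] (q : ℝ) (f : X → ℂ) : ℝ :=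
  (eLpNorm f (ENNReal.ofReal q) volume).toReal

/-- Mixed norm `‖u‖_{L^p((0,T);L^q)}`. -/
def mixedNorm {X : Type*} [MeasureSpace X] (p q T : ℝ) (u : ℝ → X → ℂ) : ℝ :=
  (∫ t in Set.Ioo (0:ℝ) T, LqNorm q (u t) ^ p) ^ (1/p)

/-- A smooth compactly supported cutoff `ψ` with `0 ≤ ψ ≤ 1`, `ψ s = 0` for `|s| > 1`
and `ψ s = 1` for `|s| < 1/2`. -/
def IsCutoff (ψ : ℝ → ℝ) : Prop :=
  ContDiff ℝ (⊤ : ℕ∞) ψ ∧ HasCompactSupport ψ ∧ (∀ s, 0 ≤ ψ s ∧ ψ s ≤ 1) ∧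
    (∀ s, 1 < |s| → ψ s = 0) ∧ (∀ s, |s| < 1/2 → ψ s = 1)

/-- `v` is a smooth nonzero eigenfunction of the twisted Laplacian on `Fin m → ℝ`
with eigenvalue `lam`, such that `v` and `∇v` lie in every `L^p`, `1 ≤ p < ∞`. -/
def IsEigen (m : ℕ) (lam : ℝ) (v : (Fin m → ℝ) → ℂ) : Prop :=
  ContDiff ℝ (⊤ : ℕ∞) v ∧ v ≠ 0 ∧ (∀ y, twistedLap m v y = (lam : ℂ) * v y) ∧
    (∀ p : ℝ, 1 ≤ p → MemLp v (ENNReal.ofReal p) volume) ∧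
    (∀ p : ℝ, 1 ≤ p → ∀ i, MemLp (pd v i) (ENNReal.ofReal p) volume)

/-- Schrödinger admissibility: `p, q ≥ 2` and `2/p = n/2 - n/q`. -/
def SAdmissible (n : ℕ) (p q : ℝ) : Prop :=
  2 ≤ p ∧ 2 ≤ q ∧ 2 / p = (n : ℝ) / 2 - (n : ℝ) / q

/-- The magnetic potential `A(x) = |x|^{-α} (Mmat n k) x` on `ℝⁿ`. -/
def Afield (n k : ℕ) (α : ℝ) (x : Fin n → ℝ) : Fin n → ℝ :=
  fun i => euclNorm x ^ (-α) * (Mmat n k).mulVec x i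

/-- Residual `i ∂_t u - Δu + 2i A·∇u + |A|² u` of the inhomogeneous magnetic
Schrödinger equation `i ∂_t u + H u = F`, `H = -Δ + 2iA·∇ + |A|²`, on `ℝⁿ`. -/
def schroedResid (n k : ℕ) (α : ℝ) (u : ℝ → (Fin n → ℝ) → ℂ) (t : ℝ)
    (x : Fin n → ℝ) : ℂ :=
  Complex.I * deriv (fun s => u s x) t - lapV (u t) x
    + 2 * Complex.I * ∑ i, ((Afield n k α x i : ℝ) : ℂ) * pd (u t) i x
    + ((euclNorm (Afield n k α x) ^ 2 : ℝ) : ℂ) * u t x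

def dd (m : ℕ) (i : Fin (m+1)) : ℝ := if i = Fin.last m then 0 else 1
def rr (m : ℕ) (R : ℝ) (i : Fin (m+1)) : ℝ := if i = Fin.last m then R else 0
def YY (m : ℕ) (x : Fin (m+1) → ℝ) : ℝ := ∑ i, dd m i * x i ^ 2
def PP (m : ℕ) (R : ℝ) (x : Fin (m+1) → ℝ) : ℝ := ∑ i, (x i - rr m R i) ^ 2
def hh (m : ℕ) (a b R : ℝ) (ψ : ℝ → ℝ) (x : Fin (m+1) → ℝ) : ℝ :=
  Real.exp (-a/2 * YY m x) * ψ (b * PP m R x)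

lemma dd_sq (m : ℕ) (i : Fin (m+1)) : dd m i * dd m i = dd m i := by
  unfold dd; split_ifs <;> norm_num

lemma dd_rr (m : ℕ) (R : ℝ) (i : Fin (m+1)) : dd m i * rr m R i = 0 := by
  unfold dd rr; split_ifs <;> norm_num

lemma sum_dd (m : ℕ) : ∑ i, dd m i = m := by
  rw [Fin.sum_univ_castSucc]; simp [dd, Fin.castSucc_ne_last]

lemma YY_eq (m : ℕ) (x : Fin (m+1) → ℝ) : YY m x = ∑ i : Fin m, x i.castSucc ^ 2 := by
  unfold YY; rw [Fin.sum_univ_castSucc]; simp [dd, Fin.castSucc_ne_last]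

lemma PP_eq (m : ℕ) (R : ℝ) (x : Fin (m+1) → ℝ) :
    PP m R x = YY m x + (x (Fin.last m) - R) ^ 2 := by
  rw [YY_eq]
  unfold PP; rw [Fin.sum_univ_castSucc]; simp [rr, Fin.castSucc_ne_last]

lemma contDiff_YY (m : ℕ) : ContDiff ℝ (⊤ : ℕ∞) (YY m) := by
  unfold YY; fun_prop

lemma contDiff_PP (m : ℕ) (R : ℝ) : ContDiff ℝ (⊤ : ℕ∞) (PP m R) := by
  unfold PP; fun_prop

lemma hasFDerivAt_coord {m : ℕ} (i : Fin (m+1)) (x : Fin (m+1) → ℝ) :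
    HasFDerivAt (fun x : Fin (m+1) → ℝ => x i)
      (ContinuousLinearMap.proj (R := ℝ) (φ := fun _ : Fin (m+1) => ℝ) i) x :=
  hasFDerivAt_apply i x

lemma lineD_YY (m : ℕ) (x : Fin (m+1) → ℝ) (i : Fin (m+1)) :
    fderiv ℝ (YY m) x (Pi.single i 1) = 2 * dd m i * x i := by
  have h : HasFDerivAt (YY m) _ x := HasFDerivAt.fun_sum (u := Finset.univ)
    (fun j _ => ((hasFDerivAt_coord j x).pow 2).const_mul (dd m j))
  rw [h.fderiv]
  simp [Pi.single_apply]
  ring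

lemma lineD_PP (m : ℕ) (R : ℝ) (x : Fin (m+1) → ℝ) (i : Fin (m+1)) :
    fderiv ℝ (PP m R) x (Pi.single i 1) = 2 * (x i - rr m R i) := by
  have h : HasFDerivAt (PP m R) _ x := HasFDerivAt.fun_sum (u := Finset.univ)
    (fun j _ => ((hasFDerivAt_coord j x).sub_const (rr m R j)).pow 2)
  rw [h.fderiv]
  simp [Pi.single_apply]

lemma hasFDerivAt_hh (m : ℕ) (a b R : ℝ) (ψ ψ' : ℝ → ℝ) (hψ : ∀ s, HasDerivAt ψ (ψ' s) s)
    (x : Fin (m+1) → ℝ) : DifferentiableAt ℝ (hh m a b R ψ) x ∧ ∀ i,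
    fderiv ℝ (hh m a b R ψ) x (Pi.single i 1) =
      -a * dd m i * x i * hh m a b R ψ x + 2 * b * (x i - rr m R i) * hh m a b R ψ' x := by
  have hY : HasFDerivAt (YY m) (fderiv ℝ (YY m) x) x :=
    ((contDiff_YY m).differentiable (by simp) x).hasFDerivAt
  have hP : HasFDerivAt (PP m R) (fderiv ℝ (PP m R) x) x :=
    ((contDiff_PP m R).differentiable (by simp) x).hasFDerivAt
  have h1 := (hY.const_mul (-a/2)).exp
  have h2 := (hψ (b * PP m R x)).comp_hasFDerivAt x (hP.const_mul b)
  have h : HasFDerivAt (hh m a b R ψ) _ x := h1.mul h2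
  refine ⟨h.differentiableAt, fun i => ?_⟩
  rw [h.fderiv]
  simp [lineD_YY, lineD_PP, hh]
  ring

lemma pd_real {m : ℕ} (c : ℂ) (h : (Fin (m+1) → ℝ) → ℝ) (x : Fin (m+1) → ℝ)
    (hd : DifferentiableAt ℝ h x) (i : Fin (m+1)) :
    pd (fun x => c * (h x : ℂ)) i x = c * ((fderiv ℝ h x (Pi.single i 1) : ℝ) : ℂ) := by
  unfold pd
  have h1 : HasFDerivAt (fun x => c * (h x : ℂ)) _ x :=
    (Complex.ofRealCLM.hasFDerivAt.comp x hd.hasFDerivAt).const_mul c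
  rw [h1.fderiv]
  simp

lemma pd_hh (m : ℕ) (a b R : ℝ) (ψ ψ' : ℝ → ℝ) (hψ : ∀ s, HasDerivAt ψ (ψ' s) s) (c : ℂ)
    (i : Fin (m+1)) :
    pd (fun x => c * (hh m a b R ψ x : ℂ)) i = fun x => c *
      ((-a * dd m i * x i * hh m a b R ψ x + 2 * b * (x i - rr m R i) * hh m a b R ψ' x : ℝ) : ℂ) := by
  funext x
  rw [pd_real c _ x (hasFDerivAt_hh m a b R ψ ψ' hψ x).1, (hasFDerivAt_hh m a b R ψ ψ' hψ x).2]

lemma pd_pd_hh (m : ℕ) (a b R : ℝ) (ψ ψ' ψ'' : ℝ → ℝ) (hψ : ∀ s, HasDerivAt ψ (ψ' s) s)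
    (hψ' : ∀ s, HasDerivAt ψ' (ψ'' s) s) (c : ℂ) (i : Fin (m+1)) (x : Fin (m+1) → ℝ) :
    pd (pd (fun x => c * (hh m a b R ψ x : ℂ)) i) i x = c *
      ((-a * dd m i * hh m a b R ψ x + a^2 * (dd m i * x i ^ 2) * hh m a b R ψ x
        - 4 * a * b * (dd m i * x i^2) * hh m a b R ψ' x
        + 2 * b * hh m a b R ψ' x
        + 4 * b^2 * (x i - rr m R i)^2 * hh m a b R ψ'' x : ℝ) : ℂ) := by
  rw [pd_hh m a b R ψ ψ' hψ]
  obtain ⟨d1, e1⟩ := hasFDerivAt_hh m a b R ψ ψ' hψ x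
  obtain ⟨d2, e2⟩ := hasFDerivAt_hh m a b R ψ' ψ'' hψ' x
  have hc := hasFDerivAt_coord i x
  have h : HasFDerivAt (fun x : Fin (m+1) → ℝ =>
    -a * dd m i * x i * hh m a b R ψ x + 2 * b * (x i - rr m R i) * hh m a b R ψ' x) _ x :=
    ((hc.const_mul (-a * dd m i)).mul d1.hasFDerivAt).add
      (((hc.sub_const (rr m R i)).const_mul (2*b)).mul d2.hasFDerivAt)
  rw [pd_real c _ x h.differentiableAt, h.fderiv]
  simp only [add_apply, smul_apply, e1, e2,
    ContinuousLinearMap.proj_apply, Pi.single_eq_same, smul_eq_mul]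
  congr 2
  linear_combination (a^2 * x i^2 * hh m a b R ψ x) * dd_sq m i
    + (4 * a * b * x i * hh m a b R ψ' x) * dd_rr m R i

lemma lapV_hh (m : ℕ) (a b R : ℝ) (ψ ψ' ψ'' : ℝ → ℝ) (hψ : ∀ s, HasDerivAt ψ (ψ' s) s)
    (hψ' : ∀ s, HasDerivAt ψ' (ψ'' s) s) (c : ℂ) (x : Fin (m+1) → ℝ) :
    lapV (fun x => c * (hh m a b R ψ x : ℂ)) x = c *
      ((-a * m * hh m a b R ψ x + a^2 * YY m x * hh m a b R ψ x
        - 4 * a * b * YY m x * hh m a b R ψ' x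
        + 2 * b * (m+1) * hh m a b R ψ' x
        + 4 * b^2 * PP m R x * hh m a b R ψ'' x : ℝ) : ℂ) := by
  unfold lapV
  simp_rw [pd_pd_hh m a b R ψ ψ' ψ'' hψ hψ' c]
  rw [← Finset.mul_sum, ← Complex.ofReal_sum]
  congr 2
  simp only [Finset.sum_add_distrib, Finset.sum_sub_distrib, ← Finset.mul_sum, ← Finset.sum_mul,
    sum_dd]
  simp [YY, PP]
  ring

lemma Mmat_last (m : ℕ) (x : Fin (m+1) → ℝ) : (Mmat (m+1) m).mulVec x (Fin.last m) = 0 := by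
  simp [Matrix.mulVec, dotProduct, Mmat]

lemma Mmat_anti (m : ℕ) : (Mmat (m+1) m).transpose = -Mmat (m+1) m := by
  ext i j
  simp only [Matrix.transpose_apply, Matrix.neg_apply, Mmat]
  split_ifs <;> first | omega | norm_num

lemma Mmat_dot (m : ℕ) (x : Fin (m+1) → ℝ) : ∑ i, (Mmat (m+1) m).mulVec x i * x i = 0 := by
  have h : (Mmat (m+1) m).mulVec x ⬝ᵥ x = - ((Mmat (m+1) m).mulVec x ⬝ᵥ x) := by
    conv_lhs => rw [dotProduct_comm, Matrix.dotProduct_mulVec, ← Matrix.mulVec_transpose, Mmat_anti,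
      Matrix.neg_mulVec, neg_dotProduct]
  simp only [dotProduct] at h
  linarith

lemma Mmat_sq (m : ℕ) (hm : Even m) (x : Fin (m+1) → ℝ) :
    ∑ i, (Mmat (m+1) m).mulVec x i ^ 2 = YY m x := by
  rw [Fin.sum_univ_castSucc, Mmat_last, YY_eq]
  simp only [ne_eq, OfNat.ofNat_ne_zero, not_false_eq_true, zero_pow, add_zero]
  obtain ⟨k, hk⟩ := hm
  let σ : Fin m → Fin m := fun i => if h : i.val % 2 = 0 then ⟨i.val + 1, by omega⟩
    else ⟨i.val - 1, by omega⟩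
  have hσ : ∀ i, σ (σ i) = i := by
    intro i
    have hs : ∀ i, (σ i).val = if i.val % 2 = 0 then i.val + 1 else i.val - 1 := by
      intro i; simp only [σ]; split_ifs <;> rfl
    ext
    rw [hs, hs]
    split_ifs <;> omega
  refine Finset.sum_nbij' σ σ (by simp) (by simp) (fun i _ => hσ i) (fun i _ => hσ i) ?_
  intro i _
  have : (Mmat (m+1) m).mulVec x i.castSucc = (if i.val % 2 = 0 then 1 else -1) * x (σ i).castSucc := by
    simp only [Matrix.mulVec, dotProduct]
    rw [Finset.sum_eq_single (σ i).castSucc]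
    · congr 1
      simp only [Mmat, σ]
      split_ifs <;> simp_all <;> omega
    · intro j _ hj
      have : Mmat (m+1) m i.castSucc j = 0 := by
        have : j.val ≠ (σ i).val := fun h => hj (by ext; simpa using h)
        simp only [Mmat, σ] at *
        have hi := i.2
        split_ifs at * <;> simp_all <;> omega
      rw [this, zero_mul]
    · simp
  rw [this]
  split_ifs <;> ring

lemma eucl_Afield (m : ℕ) (hm : Even m) (α : ℝ) (x : Fin (m+1) → ℝ) :
    euclNorm (Afield (m+1) m α x) ^ 2 = (euclNorm x ^ (-α))^2 * YY m x := by
  unfold euclNorm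
  rw [Real.sq_sqrt (by positivity)]
  simp only [Afield, mul_pow, ← Finset.mul_sum, Mmat_sq m hm]
  rfl

lemma first_order (m : ℕ) (a b R α : ℝ) (ψ ψ' : ℝ → ℝ) (hψ : ∀ s, HasDerivAt ψ (ψ' s) s)
    (c : ℂ) (x : Fin (m+1) → ℝ) :
    ∑ i, ((Afield (m+1) m α x i : ℝ) : ℂ) * pd (fun x => c * (hh m a b R ψ x : ℂ)) i x = 0 := by
  simp_rw [pd_hh m a b R ψ ψ' hψ c]
  have hA : ∀ i, Afield (m+1) m α x i * dd m i = Afield (m+1) m α x i := by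
    intro i
    by_cases h : i = Fin.last m
    · subst h; simp [Afield, Mmat_last]
    · simp [dd, h]
  have hR : ∀ i, Afield (m+1) m α x i * rr m R i = 0 := by
    intro i
    by_cases h : i = Fin.last m
    · subst h; simp [Afield, Mmat_last]
    · simp [rr, h]
  have hS : ∑ i, Afield (m+1) m α x i * x i = 0 := by
    simp only [Afield, mul_assoc, ← Finset.mul_sum, Mmat_dot, mul_zero]
  have : ∀ i, ((Afield (m+1) m α x i : ℝ) : ℂ) * (c * ((-a * dd m i * x i * hh m a b R ψ x
      + 2 * b * (x i - rr m R i) * hh m a b R ψ' x : ℝ) : ℂ)) =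
      (c * ((-a * hh m a b R ψ x + 2 * b * hh m a b R ψ' x : ℝ) : ℂ)) *
        ((Afield (m+1) m α x i * x i : ℝ) : ℂ) := by
    intro i
    rw [mul_left_comm, ← Complex.ofReal_mul, mul_assoc c, ← Complex.ofReal_mul]
    congr 2
    linear_combination (-a * x i * hh m a b R ψ x) * hA i - (2 * b * hh m a b R ψ' x) * hR i
  simp_rw [this]
  rw [← Finset.mul_sum, ← Complex.ofReal_sum, hS]
  simp

lemma resid_hh (m : ℕ) (hm : Even m) (a b R α : ℝ) (ψ ψ' ψ'' : ℝ → ℝ)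
    (hψ : ∀ s, HasDerivAt ψ (ψ' s) s)
    (hψ' : ∀ s, HasDerivAt ψ' (ψ'' s) s) (t : ℝ) (x : Fin (m+1) → ℝ) :
    schroedResid (m+1) m α
      (fun t x => Complex.exp (Complex.I * ((a * m * t : ℝ) : ℂ)) * (hh m a b R ψ x : ℂ)) t x =
    Complex.exp (Complex.I * ((a * m * t : ℝ) : ℂ)) *
      ((((euclNorm x ^ (-α))^2 - a^2) * YY m x * hh m a b R ψ x
        + 4 * a * b * YY m x * hh m a b R ψ' x
        - 2 * b * (m+1) * hh m a b R ψ' x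
        - 4 * b^2 * PP m R x * hh m a b R ψ'' x : ℝ) : ℂ) := by
  unfold schroedResid
  rw [lapV_hh m a b R ψ ψ' ψ'' hψ hψ', first_order m a b R α ψ ψ' hψ, eucl_Afield m hm]
  have hd : HasDerivAt (fun s : ℝ => Complex.exp (Complex.I * ((a * m * s : ℝ) : ℂ)) *
      (hh m a b R ψ x : ℂ)) (Complex.exp (Complex.I * ((a * m * t : ℝ) : ℂ)) *
        (Complex.I * ((a * m : ℝ) : ℂ)) * (hh m a b R ψ x : ℂ)) t := by
    have h0 : HasDerivAt (fun s : ℝ => ((a * m * s : ℝ) : ℂ)) ((a * m : ℝ) : ℂ) t := by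
      have := ((hasDerivAt_id t).const_mul (a * m : ℝ)).ofReal_comp
      simpa using this
    exact ((h0.const_mul Complex.I).cexp).mul_const _
  rw [hd.deriv]
  push_cast
  linear_combination (Complex.exp (Complex.I * (a * m * t)) * (a * m) * (hh m a b R ψ x : ℂ)) * Complex.I_sq
def gg (m : ℕ) (l L R : ℝ) (i : Fin (m+1)) (s : ℝ) : ℝ :=
  if i = Fin.last m then (Set.Icc (R - l*L) (R + l*L)).indicator (fun _ => (1:ℝ)) s
  else Real.exp (-((l^2)⁻¹/4) * s^2)

def cst (m : ℕ) (r : ℝ) : ℝ := 2 * Real.sqrt (4 * Real.pi / r) ^ m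

lemma cst_pos (m : ℕ) (r : ℝ) (hr : 0 < r) : 0 < cst m r := by
  unfold cst; have := Real.pi_pos; positivity

lemma gg_nonneg (m : ℕ) (l L R : ℝ) (i : Fin (m+1)) (s : ℝ) : 0 ≤ gg m l L R i s := by
  unfold gg
  split_ifs
  · exact Set.indicator_nonneg (by simp) _
  · positivity

lemma gg_rpow_last (m : ℕ) (l L R r : ℝ) (hr : 0 < r) :
    (fun s => gg m l L R (Fin.last m) s ^ r) =
      (Set.Icc (R - l*L) (R + l*L)).indicator (fun _ => (1:ℝ)) := by
  funext s
  by_cases h : s ∈ Set.Icc (R - l*L) (R + l*L)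
  · simp [gg, Set.indicator_of_mem h]
  · simp [gg, Set.indicator_of_notMem h, Real.zero_rpow hr.ne']

lemma gg_rpow_cast (m : ℕ) (l L R r : ℝ) (i : Fin (m+1)) (hi : i ≠ Fin.last m) :
    (fun s => gg m l L R i s ^ r) = fun s => Real.exp (-(r * (l^2)⁻¹/4) * s^2) := by
  funext s
  simp only [gg, hi, if_false]
  rw [← Real.exp_mul]
  congr 1; ring

lemma gg_integrable (m : ℕ) (l L R r : ℝ) (hl : 0 < l) (hr : 0 < r) (i : Fin (m+1)) :
    Integrable (fun s => gg m l L R i s ^ r) := by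
  by_cases hi : i = Fin.last m
  · subst hi
    rw [gg_rpow_last m l L R r hr, integrable_indicator_iff measurableSet_Icc]
    simp
  · rw [gg_rpow_cast m l L R r i hi]
    exact integrable_exp_neg_mul_sq (by positivity)

lemma gg_integral (m : ℕ) (l L R r : ℝ) (hl : 0 < l) (hL : 0 < L) (hr : 0 < r) :
    ∏ i, ∫ s, gg m l L R i s ^ r = cst m r * (l^(m+1) * L) := by
  rw [Fin.prod_univ_castSucc]
  rw [gg_rpow_last m l L R r hr]
  have : ∀ i : Fin m, ∫ s, gg m l L R i.castSucc s ^ r = l * Real.sqrt (4 * Real.pi / r) := by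
    intro i
    rw [gg_rpow_cast m l L R r _ (Fin.castSucc_ne_last i), integral_gaussian]
    rw [show Real.pi / (r * (l^2)⁻¹/4) = l^2 * (4 * Real.pi / r) by field_simp]
    rw [Real.sqrt_mul (by positivity), Real.sqrt_sq hl.le]
  simp only [this]
  rw [integral_indicator_const _ measurableSet_Icc, Real.volume_real_Icc_of_le (by nlinarith [mul_pos hl hL])]
  simp only [Finset.prod_const, Finset.card_univ, Fintype.card_fin, smul_eq_mul, cst, mul_pow]
  ring

lemma prod_gg_eq (m : ℕ) (l L R : ℝ) (x : Fin (m+1) → ℝ) (h : |x (Fin.last m) - R| ≤ l * L) :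
    ∏ i, gg m l L R i (x i) = Real.exp (-((l^2)⁻¹/4) * YY m x) := by
  rw [Fin.prod_univ_castSucc, YY_eq]
  have h2 : x (Fin.last m) ∈ Set.Icc (R - l*L) (R + l*L) := by
    rw [abs_le] at h; constructor <;> linarith
  simp only [gg, Fin.castSucc_ne_last, if_false, if_true, Set.indicator_of_mem h2, mul_one]
  rw [← Real.exp_sum, Finset.mul_sum]

lemma upper (m : ℕ) (l L R r c : ℝ) (hl : 0 < l) (hL : 0 < L) (hr : 1 ≤ r) (hc : 0 ≤ c)
    (G : (Fin (m+1) → ℝ) → ℂ)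
    (hG1 : ∀ x, |x (Fin.last m) - R| ≤ l * L → ‖G x‖ ≤ c * Real.exp (-((l^2)⁻¹/4) * YY m x))
    (hG2 : ∀ x, ¬ |x (Fin.last m) - R| ≤ l * L → G x = 0) :
    eLpNorm G (ENNReal.ofReal r) volume ≤
      ENNReal.ofReal (c * (cst m r * (l^(m+1) * L)) ^ (1/r)) := by
  have hr0 : 0 < r := by linarith
  have h1 : ∀ x, ‖G x‖ ≤ c * ∏ i, gg m l L R i (x i) := by
    intro x
    by_cases h : |x (Fin.last m) - R| ≤ l * L
    · rw [prod_gg_eq m l L R x h]; exact hG1 x h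
    · rw [hG2 x h, norm_zero]
      exact mul_nonneg hc (Finset.prod_nonneg fun i _ => gg_nonneg m l L R i _)
  refine (eLpNorm_mono_real h1).trans ?_
  have hp0 : ENNReal.ofReal r ≠ 0 := by simpa using hr0
  rw [eLpNorm_eq_lintegral_rpow_enorm_toReal hp0 ENNReal.ofReal_ne_top,
    ENNReal.toReal_ofReal hr0.le]
  have e1 : ∀ x : Fin (m+1) → ℝ, ‖c * ∏ i, gg m l L R i (x i)‖ₑ ^ r =
      ENNReal.ofReal (c ^ r * ∏ i, gg m l L R i (x i) ^ r) := by
    intro x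
    have hn : 0 ≤ ∏ i, gg m l L R i (x i) := Finset.prod_nonneg fun i _ => gg_nonneg m l L R i _
    rw [Real.enorm_eq_ofReal (mul_nonneg hc hn), ENNReal.ofReal_rpow_of_nonneg (mul_nonneg hc hn) hr0.le,
      Real.mul_rpow hc hn, Real.finsetProd_rpow _ _ (fun i _ => gg_nonneg m l L R i _)]
  simp_rw [e1]
  have hint : Integrable (fun x : Fin (m+1) → ℝ => ∏ i, gg m l L R i (x i) ^ r) :=
    Integrable.fintype_prod (f := fun i s => gg m l L R i s ^ r)
      (fun i => gg_integrable m l L R r hl hr0 i)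
  rw [← ofReal_integral_eq_lintegral_ofReal (hint.const_mul _)
    (Eventually.of_forall fun x => mul_nonneg (Real.rpow_nonneg hc _)
      (Finset.prod_nonneg fun i _ => Real.rpow_nonneg (gg_nonneg m l L R i _) _)),
    integral_const_mul,
    integral_fintype_prod_volume_eq_prod (f := fun i s => gg m l L R i s ^ r), gg_integral m l L R r hl hL hr0]
  have hcp := cst_pos m r hr0
  rw [ENNReal.ofReal_rpow_of_nonneg (by positivity) (by positivity),
    Real.mul_rpow (by positivity) (by positivity), ← Real.rpow_mul hc, mul_one_div_cancel hr0.ne', Real.rpow_one]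

lemma lower (m : ℕ) (l L R r c : ℝ) (hl : 0 < l) (hL : 0 < L) (hr : 1 ≤ r) (hc : 0 ≤ c)
    (G : (Fin (m+1) → ℝ) → ℂ)
    (hG : ∀ x : Fin (m+1) → ℝ, (∀ i : Fin m, |x i.castSucc| ≤ l) →
      |x (Fin.last m) - R| ≤ l * L / 2 → c ≤ ‖G x‖) :
    ENNReal.ofReal (c * (l^(m+1) * L) ^ (1/r)) ≤ eLpNorm G (ENNReal.ofReal r) volume := by
  have hr0 : 0 < r := by linarith
  have hp0 : ENNReal.ofReal r ≠ 0 := by simpa using hr0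
  let lo : Fin (m+1) → ℝ := fun i => if i = Fin.last m then R - l * L/2 else -l
  let hi : Fin (m+1) → ℝ := fun i => if i = Fin.last m then R + l * L/2 else l
  have key : eLpNorm ((Set.Icc lo hi).indicator (fun _ => c)) (ENNReal.ofReal r) volume ≤
      eLpNorm G (ENNReal.ofReal r) volume := by
    refine eLpNorm_mono fun x => ?_
    by_cases hx : x ∈ Set.Icc lo hi
    · rw [Set.indicator_of_mem hx, Real.norm_of_nonneg hc]
      apply hG
      · intro i
        have h1 := hx.1 i.castSucc
        have h2 := hx.2 i.castSucc
        simp only [lo, hi, Fin.castSucc_ne_last, if_false] at h1 h2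
        exact abs_le.2 ⟨h1, h2⟩
      · have h1 := hx.1 (Fin.last m)
        have h2 := hx.2 (Fin.last m)
        simp only [lo, hi, if_true] at h1 h2
        exact abs_le.2 ⟨by linarith, by linarith⟩
    · rw [Set.indicator_of_notMem hx]; simp
  refine le_trans ?_ key
  rw [eLpNorm_indicator_const measurableSet_Icc hp0 ENNReal.ofReal_ne_top,
    ENNReal.toReal_ofReal hr0.le, Real.volume_Icc_pi, ← ENNReal.ofReal_prod_of_nonneg,
    Real.enorm_eq_ofReal hc, ENNReal.ofReal_rpow_of_nonneg _ (by positivity), ← ENNReal.ofReal_mul hc]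
  · apply ENNReal.ofReal_le_ofReal
    gcongr
    rw [Fin.prod_univ_castSucc]
    simp only [lo, hi, Fin.castSucc_ne_last, if_false, if_true, Finset.prod_const, Finset.card_univ, Fintype.card_fin]
    have : l ^ m ≤ (l - -l)^m := by gcongr; linarith
    calc l^(m+1) * L = l^m * (l * L) := by ring
      _ ≤ (l - -l)^m * (l * L) := by gcongr
      _ = _ := by ring
  · apply Finset.prod_nonneg
    intro i _
    have := mul_pos hl hL
    simp only [lo, hi]
    split_ifs <;> linarith
  · intro i _
    have := mul_pos hl hL
    simp only [lo, hi]
    split_ifs <;> linarith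

lemma mixedNorm_const {X : Type*} [MeasureSpace X] (p q T N : ℝ) (hp : 0 < p) (hT : 0 < T)
    (hN : 0 ≤ N) (u : ℝ → X → ℂ) (h : ∀ t, LqNorm q (u t) = N) :
    mixedNorm p q T u = T ^ (1/p) * N := by
  unfold mixedNorm
  simp only [h]
  rw [setIntegral_const, Real.volume_real_Ioo_of_le hT.le, sub_zero, smul_eq_mul,
    Real.mul_rpow hT.le (by positivity), ← Real.rpow_mul hN, mul_one_div_cancel hp.ne', Real.rpow_one]

lemma exists_cutoff : ∃ (φ φ1 φ2 : ℝ → ℝ) (B : ℝ), 1 ≤ B ∧ ContDiff ℝ (⊤ : ℕ∞) φ ∧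
    (∀ s, HasDerivAt φ (φ1 s) s) ∧ (∀ s, HasDerivAt φ1 (φ2 s) s) ∧
    (∀ s, s ≤ 1/2 → φ s = 1) ∧ (∀ s, 1 < s → φ s = 0 ∧ φ1 s = 0 ∧ φ2 s = 0) ∧
    (∀ s ∈ Set.Icc (0:ℝ) 1, |φ s| ≤ B ∧ |φ1 s| ≤ B ∧ |φ2 s| ≤ B) := by
  let φ : ℝ → ℝ := fun s => Real.smoothTransition (2 - 2 * s)
  have h0 : ContDiff ℝ (⊤ : ℕ∞) φ := Real.smoothTransition.contDiff.comp (by fun_prop)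
  have h1 : ContDiff ℝ (⊤ : ℕ∞) (deriv φ) := (contDiff_infty_iff_deriv.1 h0).2
  have h2 : ContDiff ℝ (⊤ : ℕ∞) (deriv (deriv φ)) := (contDiff_infty_iff_deriv.1 h1).2
  have z0 : ∀ s, 1 < s → φ s = 0 := fun s hs => Real.smoothTransition.zero_of_nonpos (by linarith)
  have zz : ∀ f : ℝ → ℝ, (∀ s, 1 < s → f s = 0) → ∀ s, 1 < s → deriv f s = 0 := by
    intro f hf s hs
    have : f =ᶠ[nhds s] fun _ => 0 := by
      filter_upwards [lt_mem_nhds hs] with y hy using hf y hy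
    rw [this.deriv_eq]; simp
  have bd : ∀ f : ℝ → ℝ, Continuous f → ∃ B, ∀ s ∈ Set.Icc (0:ℝ) 1, |f s| ≤ B := by
    intro f hf
    obtain ⟨B, hB⟩ := isCompact_Icc.exists_bound_of_continuousOn (s := Set.Icc (0:ℝ) 1) hf.continuousOn
    exact ⟨B, hB⟩
  obtain ⟨B0, hB0⟩ := bd _ h0.continuous
  obtain ⟨B1, hB1⟩ := bd _ h1.continuous
  obtain ⟨B2, hB2⟩ := bd _ h2.continuous
  refine ⟨φ, deriv φ, deriv (deriv φ), max 1 (max B0 (max B1 B2)), le_max_left _ _, h0,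
    fun s => (h0.differentiable (by simp) s).hasDerivAt,
    fun s => (h1.differentiable (by simp) s).hasDerivAt,
    fun s hs => Real.smoothTransition.one_of_one_le (by linarith),
    fun s hs => ⟨z0 s hs, zz _ z0 s hs, zz _ (zz _ z0) s hs⟩, fun s hs => ⟨?_, ?_, ?_⟩⟩
  · exact (hB0 s hs).trans (by simp)
  · exact (hB1 s hs).trans (by simp)
  · exact (hB2 s hs).trans (by simp)
lemma YY_nonneg (m : ℕ) (x : Fin (m+1) → ℝ) : 0 ≤ YY m x := by
  rw [YY_eq]; positivity

lemma PP_nonneg (m : ℕ) (R : ℝ) (x : Fin (m+1) → ℝ) : 0 ≤ PP m R x := by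
  unfold PP; positivity

lemma contDiff_hh (m : ℕ) (a b R : ℝ) (ψ : ℝ → ℝ) (hψ : ContDiff ℝ (⊤ : ℕ∞) ψ) :
    ContDiff ℝ (⊤ : ℕ∞) (hh m a b R ψ) := by
  have h1 := contDiff_YY m
  have h2 := contDiff_PP m R
  unfold hh
  exact (Real.contDiff_exp.comp (contDiff_const.mul h1)).mul (hψ.comp (contDiff_const.mul h2))

lemma exp_bound (η : ℝ) : Real.exp (-η/2) * η ≤ 4 * Real.exp (-η/4) := by
  have h1 : η / 4 ≤ Real.exp (η/4) := by linarith [Real.add_one_le_exp (η/4)]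
  have h2 : Real.exp (-η/2) = Real.exp (-η/4) * Real.exp (-η/4) := by
    rw [← Real.exp_add]; congr 1; ring
  have h3 : Real.exp (-η/4) * Real.exp (η/4) = 1 := by
    rw [← Real.exp_add, ← Real.exp_zero]; congr 1; ring
  have h4 := Real.exp_pos (-η/4)
  have h5 : Real.exp (-η/4) * (η/4) ≤ 1 := by
    rw [← h3]; gcongr
  rw [h2]
  nlinarith

lemma resid_bound (m : ℕ) (a b R W B Li : ℝ) (ha : 0 < a) (hb : 0 < b) (hB : 0 ≤ B)
    (hab : b = a * Li)
    (φ φ1 φ2 : ℝ → ℝ)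
    (hφ : ∀ s ∈ Set.Icc (0:ℝ) 1, |φ s| ≤ B ∧ |φ1 s| ≤ B ∧ |φ2 s| ≤ B)
    (x : Fin (m+1) → ℝ) (hx : b * PP m R x ≤ 1) (hW : |W - a^2| ≤ a^2 * Li) :
    |(W - a^2) * YY m x * hh m a b R φ x
        + 4 * a * b * YY m x * hh m a b R φ1 x
        - 2 * b * (m+1) * hh m a b R φ1 x
        - 4 * b^2 * PP m R x * hh m a b R φ2 x| ≤
      b * (B * (2 * m + 26)) * Real.exp (-(a/4) * YY m x) := by
  have hY := YY_nonneg m x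
  have hP := PP_nonneg m R x
  obtain ⟨f0, f1, f2⟩ := hφ (b * PP m R x) ⟨by positivity, hx⟩
  set E := Real.exp (-a/2 * YY m x) with hE
  have hE0 : 0 < E := Real.exp_pos _
  have k : ∀ ψ : ℝ → ℝ, |ψ (b * PP m R x)| ≤ B → |hh m a b R ψ x| ≤ E * B := by
    intro ψ h
    unfold hh
    rw [abs_mul, abs_of_pos hE0]
    gcongr
  have t1 : |(W - a^2) * YY m x * hh m a b R φ x| ≤ a^2 * Li * YY m x * (E * B) := by
    rw [abs_mul, abs_mul, abs_of_nonneg hY]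
    have := k φ f0
    gcongr
    exact mul_nonneg ((abs_nonneg _).trans hW) hY
  have t2 : |4 * a * b * YY m x * hh m a b R φ1 x| ≤ 4 * a * b * YY m x * (E * B) := by
    rw [abs_mul, abs_of_nonneg (by positivity : 0 ≤ 4 * a * b * YY m x)]
    have := k φ1 f1
    gcongr
  have t3 : |2 * b * (m+1) * hh m a b R φ1 x| ≤ 2 * b * (m+1) * (E * B) := by
    rw [abs_mul, abs_of_nonneg (by positivity : 0 ≤ 2 * b * ((m:ℝ)+1))]
    have := k φ1 f1
    gcongr
  have t4 : |4 * b^2 * PP m R x * hh m a b R φ2 x| ≤ 4 * b * (E * B) := by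
    rw [abs_mul, abs_of_nonneg (by positivity : 0 ≤ 4 * b^2 * PP m R x)]
    have := k φ2 f2
    have h' : 4 * b^2 * PP m R x ≤ 4 * b := by nlinarith
    gcongr
  have s1 := abs_sub ((W - a^2) * YY m x * hh m a b R φ x
        + 4 * a * b * YY m x * hh m a b R φ1 x
        - 2 * b * (m+1) * hh m a b R φ1 x) (4 * b^2 * PP m R x * hh m a b R φ2 x)
  have s2 := abs_sub ((W - a^2) * YY m x * hh m a b R φ x
        + 4 * a * b * YY m x * hh m a b R φ1 x)
        (2 * b * (m+1) * hh m a b R φ1 x)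
  have s3 := abs_add_le ((W - a^2) * YY m x * hh m a b R φ x)
        (4 * a * b * YY m x * hh m a b R φ1 x)
  have e1 := exp_bound (a * YY m x)
  have e2 : Real.exp (-(a * YY m x)/2) ≤ Real.exp (-(a * YY m x)/4) := by
    apply Real.exp_le_exp.2; nlinarith [mul_nonneg ha.le hY]
  have e3 : E = Real.exp (-(a * YY m x)/2) := by rw [hE]; congr 1; ring
  rw [← e3] at e1 e2
  have e4 : Real.exp (-(a/4) * YY m x) = Real.exp (-(a * YY m x)/4) := by congr 1; ring
  rw [e4]
  set D := Real.exp (-(a * YY m x)/4)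
  have main : a^2 * Li * YY m x * (E * B) + 4 * a * b * YY m x * (E * B) + 2 * b * (m+1) * (E * B)
      + 4 * b * (E * B) = b * B * (5 * (E * (a * YY m x)) + (2 * m + 6) * E) := by
    rw [hab]; ring
  have main2 : b * B * (5 * (E * (a * YY m x)) + (2 * m + 6) * E) ≤
      b * B * (5 * (4 * D) + (2 * m + 6) * D) := by gcongr
  nlinarith

lemma sum_sq_eq (m : ℕ) (R : ℝ) (x : Fin (m+1) → ℝ) :
    ∑ i, x i ^ 2 = YY m x + x (Fin.last m) ^ 2 := by
  rw [YY_eq, Fin.sum_univ_castSucc]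

lemma norm_close (m : ℕ) (R : ℝ) (hR : 0 < R) (x : Fin (m+1) → ℝ) :
    (euclNorm x - R)^2 ≤ PP m R x := by
  have h1 : euclNorm x ^ 2 = YY m x + x (Fin.last m) ^ 2 := by
    unfold euclNorm
    rw [Real.sq_sqrt (by positivity), sum_sq_eq m R]
  have h0 : 0 ≤ euclNorm x := Real.sqrt_nonneg _
  have h2 : x (Fin.last m) ≤ euclNorm x :=
    le_of_abs_le (abs_le_of_sq_le_sq (by rw [h1]; linarith [YY_nonneg m x]) h0)
  rw [PP_eq]
  nlinarith

lemma choose_R (m : ℕ) (α : ℝ) (hα2 : α < 2) (L : ℝ) (hL : 0 < L) :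
    ∃ R l : ℝ, 0 < R ∧ 0 < l ∧ l * L < R ∧ ∀ x : Fin (m+1) → ℝ, PP m R x ≤ (l * L)^2 →
      |(euclNorm x ^ (-α))^2 - ((l^2)⁻¹)^2| ≤ ((l^2)⁻¹)^2 * (L^2)⁻¹ := by
  have hc : ContinuousAt (fun s : ℝ => (s ^ (-α))^2) 1 :=
    (Real.continuousAt_rpow_const 1 (-α) (Or.inl one_ne_zero)).pow 2
  obtain ⟨δ, hδ, hd⟩ := Metric.continuousAt_iff.1 hc ((L^2)⁻¹) (by positivity)
  have ht : Tendsto (fun R : ℝ => R ^ (-(1 - α/2))) atTop (nhds 0) :=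
    tendsto_rpow_neg_atTop (by linarith)
  have hpos : 0 < min δ 1 / L := by positivity
  obtain ⟨R, hR1, hR2⟩ := ((ht.eventually (gt_mem_nhds hpos)).and (eventually_gt_atTop 0)).exists
  rw [lt_div_iff₀ hL] at hR1
  have hl : (0:ℝ) < R ^ (α/2) := Real.rpow_pos_of_pos hR2 _
  have hlR : R ^ (α/2) = R ^ (-(1 - α/2)) * R := by
    nth_rewrite 3 [← Real.rpow_one R]
    rw [← Real.rpow_add hR2]; congr 1; ring
  have hlL : R ^ (α/2) * L < min δ 1 * R := by
    rw [hlR]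
    nlinarith
  have hlL1 : R ^ (α/2) * L < R := hlL.trans_le (by nlinarith [min_le_right δ 1])
  refine ⟨R, R ^ (α/2), hR2, hl, hlL1, fun x hx => ?_⟩
  have h1 : |euclNorm x - R| ≤ R ^ (α/2) * L :=
    abs_le_of_sq_le_sq ((norm_close m R hR2 x).trans hx) (by positivity)
  have h2 : |euclNorm x - R| < δ * R := (h1.trans_lt hlL).trans_le (by gcongr; exact min_le_left _ _)
  have h3 : dist (euclNorm x / R) 1 < δ := by
    rw [Real.dist_eq, show euclNorm x / R - 1 = (euclNorm x - R) / R by field_simp, abs_div,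
      abs_of_pos hR2, div_lt_iff₀ hR2]
    exact h2
  have h4 := (hd h3).le
  rw [Real.dist_eq, Real.one_rpow, one_pow, Real.div_rpow (show 0 ≤ euclNorm x from Real.sqrt_nonneg _) hR2.le] at h4
  have e : ((R ^ (α/2))^2)⁻¹ = R ^ (-α) := by
    rw [Real.rpow_neg hR2.le, ← Real.rpow_natCast, ← Real.rpow_mul hR2.le]
    congr 2; push_cast; ring
  rw [e]
  have hRa : 0 < R ^ (-α) := Real.rpow_pos_of_pos hR2 _
  have e2 : (euclNorm x ^ (-α))^2 - (R ^ (-α))^2 =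
    (R ^ (-α))^2 * ((euclNorm x ^ (-α) / R ^ (-α))^2 - 1) := by field_simp
  rw [e2, abs_mul, abs_of_pos (by positivity)]
  gcongr

lemma key_ineq (m : ℕ) (hm : Even m) (α : ℝ) (hα2 : α < 2) (p q : ℝ) (hp : 2 ≤ p) (hq : 2 ≤ q)
    (φ φ1 φ2 : ℝ → ℝ) (B : ℝ) (hB : 1 ≤ B) (hφs : ContDiff ℝ (⊤ : ℕ∞) φ)
    (hφ : ∀ s, HasDerivAt φ (φ1 s) s) (hφ1 : ∀ s, HasDerivAt φ1 (φ2 s) s)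
    (hφo : ∀ s, s ≤ 1/2 → φ s = 1) (hφz : ∀ s, 1 < s → φ s = 0 ∧ φ1 s = 0 ∧ φ2 s = 0)
    (hφb : ∀ s ∈ Set.Icc (0:ℝ) 1, |φ s| ≤ B ∧ |φ1 s| ≤ B ∧ |φ2 s| ≤ B)
    (C : ℝ) (hC : 0 < C) (H : ∀ T : ℝ, 0 < T → ∀ u : ℝ → (Fin (m+1) → ℝ) → ℂ,
        ContDiff ℝ (⊤ : ℕ∞) (fun pr : ℝ × (Fin (m+1) → ℝ) => u pr.1 pr.2) →
        (∃ K : Set (Fin (m+1) → ℝ), IsCompact K ∧ (0 : Fin (m+1) → ℝ) ∉ K ∧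
          ∀ t x, x ∉ K → u t x = 0) →
        mixedNorm p q T u ≤
          C * ((eLpNorm (u 0) 2 volume).toReal
            + mixedNorm (p / (p-1)) (q / (q-1)) T (schroedResid (m+1) m α u)))
    (L : ℝ) (hL : 4 * m + 1 ≤ L) :
    ∃ l : ℝ, 0 < l ∧ (l^2 * L^2) ^ (1/p) * (Real.exp (-m/2) * (l^(m+1) * L) ^ (1/q)) ≤
      C * (B * (cst m 2 * (l^(m+1) * L)) ^ ((1:ℝ)/2) + (l^2 * L^2) ^ (1/(p/(p-1))) *
        ((l^2 * L^2)⁻¹ * (B * (2 * m + 26)) *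
          (cst m (q/(q-1)) * (l^(m+1) * L)) ^ (1/(q/(q-1))))) := by
  have hm0 : (0:ℝ) ≤ m := Nat.cast_nonneg m
  have hL0 : 0 < L := by linarith
  obtain ⟨R, l, hR, hl, hlR, hW⟩ := choose_R m α hα2 L hL0
  refine ⟨l, hl, ?_⟩
  set a := (l^2)⁻¹ with ha
  set b := (l^2 * L^2)⁻¹ with hb
  have ha0 : 0 < a := by positivity
  have hb0 : 0 < b := by positivity
  have hab : b = a * (L^2)⁻¹ := by rw [hb, ha, mul_inv]
  have hbP : ∀ x : Fin (m+1) → ℝ, b * PP m R x ≤ 1 ↔ PP m R x ≤ (l * L)^2 := by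
    intro x
    rw [hb, inv_mul_le_iff₀ (by positivity), mul_one, mul_pow]
  have hout : ∀ x : Fin (m+1) → ℝ, ¬ |x (Fin.last m) - R| ≤ l * L → 1 < b * PP m R x := by
    intro x hx
    by_contra h
    rw [not_lt, hbP, PP_eq] at h
    exact hx (abs_le_of_sq_le_sq (by linarith [YY_nonneg m x]) (by positivity))
  let cc : ℝ → ℂ := fun t => Complex.exp (Complex.I * ((a * m * t : ℝ) : ℂ))
  have hcc : ∀ t, ‖cc t‖ = 1 := by
    intro t
    simp only [cc]
    rw [mul_comm, Complex.norm_exp_ofReal_mul_I]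
  let u : ℝ → (Fin (m+1) → ℝ) → ℂ := fun t x => cc t * (hh m a b R φ x : ℂ)
  have hhz : ∀ x, 1 < b * PP m R x → hh m a b R φ x = 0 ∧ hh m a b R φ1 x = 0 ∧
      hh m a b R φ2 x = 0 := by
    intro x hx
    obtain ⟨z0, z1, z2⟩ := hφz _ hx
    simp [hh, z0, z1, z2]
  have husm : ContDiff ℝ (⊤ : ℕ∞) (fun pr : ℝ × (Fin (m+1) → ℝ) => u pr.1 pr.2) := by
    have h1 := contDiff_hh m a b R φ hφs
    have h2 : ContDiff ℝ (⊤ : ℕ∞) cc := by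
      simp only [cc]
      exact (contDiff_const.mul (Complex.ofRealCLM.contDiff.comp (contDiff_const.mul contDiff_id))).cexp
    exact (h2.comp contDiff_fst).mul (Complex.ofRealCLM.contDiff.comp (h1.comp contDiff_snd))
  have hus : ∃ K : Set (Fin (m+1) → ℝ), IsCompact K ∧ (0 : Fin (m+1) → ℝ) ∉ K ∧
          ∀ t x, x ∉ K → u t x = 0 := by
    refine ⟨{x | PP m R x ≤ (l*L)^2}, ?_, ?_, ?_⟩
    · refine IsCompact.of_isClosed_subset
        (isCompact_Icc (a := fun i => rr m R i - l * L) (b := fun i => rr m R i + l * L))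
        (isClosed_le (contDiff_PP m R).continuous continuous_const) ?_
      intro x hx
      have hx' : PP m R x ≤ (l*L)^2 := hx
      have : ∀ i, |x i - rr m R i| ≤ l * L := by
        intro i
        refine abs_le_of_sq_le_sq (le_trans ?_ hx') (by positivity)
        exact Finset.single_le_sum (f := fun i => (x i - rr m R i)^2) (fun j _ => sq_nonneg _)
          (Finset.mem_univ i)
      exact ⟨fun i => by have := abs_le.1 (this i); simp only; linarith,
        fun i => by have := abs_le.1 (this i); simp only; linarith⟩
    · simp only [Set.mem_ofPred_eq, not_le, PP_eq, YY_eq]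
      simp
      gcongr
    · intro t x hx
      have : 1 < b * PP m R x := by
        by_contra h
        exact hx ((hbP x).1 (not_lt.1 h))
      simp [u, (hhz x this).1]
  have hub : ∀ r, 1 ≤ r → eLpNorm (u 0) (ENNReal.ofReal r) volume ≤
      ENNReal.ofReal (B * (cst m r * (l^(m+1) * L)) ^ (1/r)) := by
    intro r hr
    refine upper m l L R r B hl hL0 hr (by linarith) (u 0) ?_ ?_
    · intro x _
      simp only [u, norm_mul, hcc, one_mul, Complex.norm_real, Real.norm_eq_abs]
      by_cases h : b * PP m R x ≤ 1
      · have f0 := (hφb _ ⟨mul_nonneg hb0.le (PP_nonneg m R x), h⟩).1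
        unfold hh
        rw [abs_mul, abs_of_pos (Real.exp_pos _), mul_comm]
        have : -a/2 * YY m x ≤ -(a/4) * YY m x := by nlinarith [mul_nonneg ha0.le (YY_nonneg m x)]
        gcongr
      · rw [(hhz x (not_le.1 h)).1, abs_zero]; positivity
    · intro x hx
      simp [u, (hhz x (hout x hx)).1]
  have hulow : ENNReal.ofReal (Real.exp (-m/2) * (l^(m+1) * L) ^ (1/q)) ≤
      eLpNorm (u 0) (ENNReal.ofReal q) volume := by
    refine lower m l L R q _ hl hL0 (by linarith) (Real.exp_pos _).le (u 0) ?_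
    intro x hx1 hx2
    have hY : YY m x ≤ m * l^2 := by
      rw [YY_eq]
      calc ∑ i : Fin m, x i.castSucc ^ 2 ≤ ∑ i : Fin m, l^2 := by
            refine Finset.sum_le_sum fun i _ => ?_
            exact sq_le_sq' (by linarith [abs_le.1 (hx1 i)]) (abs_le.1 (hx1 i)).2
        _ = m * l^2 := by simp
    have hP : b * PP m R x ≤ 1/2 := by
      rw [hb, inv_mul_le_iff₀ (by positivity), PP_eq]
      have h1 : (x (Fin.last m) - R)^2 ≤ (l * L/2)^2 :=
        sq_le_sq' (by linarith [abs_le.1 hx2]) (abs_le.1 hx2).2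
      have h2 : 4 * m ≤ L^2 := by nlinarith
      nlinarith [sq_nonneg l]
    simp only [u, norm_mul, hcc, one_mul, Complex.norm_real, Real.norm_eq_abs, hh, hφo _ hP, mul_one]
    rw [abs_of_pos (Real.exp_pos _)]
    apply Real.exp_le_exp.2
    have : a * YY m x ≤ m := by
      rw [ha, inv_mul_le_iff₀ (by positivity)]; linarith
    linarith
  have hT : 0 < l^2 * L^2 := by positivity
  have key := H (l^2 * L^2) hT u husm hus
  have hq1 : 1 ≤ q / (q-1) := by rw [le_div_iff₀ (by linarith)]; linarith
  have hp1 : 0 < p / (p-1) := by apply div_pos <;> linarith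
  have hres : ∀ t x, schroedResid (m+1) m α u t x = cc t *
      ((((euclNorm x ^ (-α))^2 - a^2) * YY m x * hh m a b R φ x
        + 4 * a * b * YY m x * hh m a b R φ1 x
        - 2 * b * (m+1) * hh m a b R φ1 x
        - 4 * b^2 * PP m R x * hh m a b R φ2 x : ℝ) : ℂ) :=
    fun t x => resid_hh m hm a b R α φ φ1 φ2 hφ hφ1 t x
  have hresb : eLpNorm (schroedResid (m+1) m α u 0) (ENNReal.ofReal (q/(q-1))) volume ≤
      ENNReal.ofReal (b * (B * (2 * m + 26)) *
        (cst m (q/(q-1)) * (l^(m+1) * L)) ^ (1/(q/(q-1)))) := by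
    refine upper m l L R _ _ hl hL0 hq1 (by positivity) _ ?_ ?_
    · intro x _
      rw [hres, norm_mul, hcc, one_mul, Complex.norm_real, Real.norm_eq_abs]
      by_cases h : b * PP m R x ≤ 1
      · exact resid_bound m a b R _ B ((L^2)⁻¹) ha0 hb0 (by linarith) hab φ φ1 φ2 hφb x h
          (hW x ((hbP x).1 h))
      · obtain ⟨z0, z1, z2⟩ := hhz x (not_le.1 h)
        rw [z0, z1, z2]
        simp only [mul_zero, add_zero, sub_zero, abs_zero]
        positivity
    · intro x hx
      obtain ⟨z0, z1, z2⟩ := hhz x (hout x hx)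
      rw [hres, z0, z1, z2]
      simp
  rw [mixedNorm_const p q _ (LqNorm q (u 0)) (by linarith) hT ENNReal.toReal_nonneg u ?_,
    mixedNorm_const _ _ _ (LqNorm (q/(q-1)) (schroedResid (m+1) m α u 0)) hp1 hT
      ENNReal.toReal_nonneg _ ?_] at key
  · have n1 : Real.exp (-m/2) * (l^(m+1) * L) ^ (1/q) ≤ LqNorm q (u 0) :=
      (ENNReal.ofReal_le_iff_le_toReal
        (ne_top_of_le_ne_top ENNReal.ofReal_ne_top (hub q (by linarith)))).1 hulow
    have n2 : (eLpNorm (u 0) 2 volume).toReal ≤ B * (cst m 2 * (l^(m+1) * L)) ^ ((1:ℝ)/2) := by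
      have h := hub 2 (by norm_num)
      have hc2 := cst_pos m 2 (by norm_num)
      rw [show ENNReal.ofReal 2 = 2 by norm_num] at h
      exact ENNReal.toReal_le_of_le_ofReal (by positivity) h
    have hc3 := cst_pos m (q/(q-1)) (by linarith)
    have n3 := ENNReal.toReal_le_of_le_ofReal (by positivity) hresb
    refine le_trans (by gcongr) (key.trans ?_)
    gcongr
    exact n3
  · intro t
    unfold LqNorm
    congr 1
    refine eLpNorm_congr_norm_ae (Eventually.of_forall fun x => ?_)
    rw [hres, hres, norm_mul, norm_mul, hcc, hcc]
  · intro t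
    unfold LqNorm
    congr 1
    refine eLpNorm_congr_norm_ae (Eventually.of_forall fun x => ?_)
    simp only [u, norm_mul, hcc]

lemma final_contra (m : ℕ) (hm : 2 ≤ m) (p q c1 c2 c3 d2 d3 C : ℝ) (hpq : SAdmissible (m+1) p q)
    (hc1 : 0 < c1) (hc2 : 0 < c2) (hc3 : 0 < c3) (hd2 : 0 < d2) (hd3 : 0 < d3) (hC : 0 < C)
    (L0 : ℝ)
    (H : ∀ L, L0 ≤ L → ∃ l : ℝ, 0 < l ∧ (l^2 * L^2) ^ (1/p) * (c1 * (l^(m+1) * L) ^ (1/q)) ≤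
      C * (d2 * (c2 * (l^(m+1) * L)) ^ ((1:ℝ)/2) + (l^2 * L^2) ^ (1/(p/(p-1))) *
        ((l^2 * L^2)⁻¹ * d3 *
          (c3 * (l^(m+1) * L)) ^ (1/(q/(q-1)))))) : False := by
  obtain ⟨hp, hq, he⟩ := hpq
  push_cast at he
  have hp0 : 0 < p := by linarith
  have hq0 : 0 < q := by linarith
  have hm' : (2:ℝ) ≤ m := by exact_mod_cast hm
  have hpi : 0 < 2 / p := by positivity
  have hκ' : 0 < 1/2 - 1/q := by
    have : 2 / p = ((m:ℝ)+1) * (1/2 - 1/q) := by rw [he]; ring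
    rw [this] at hpi
    exact pos_of_mul_pos_right hpi (by linarith)
  set κ := (m:ℝ) * (1/2 - 1/q) with hκ
  have hκ0 : 0 < κ := by positivity
  set D := C * (d2 * c2 ^ ((1:ℝ)/2) + d3 * c3 ^ (1/(q/(q-1)))) with hD
  have ht := tendsto_rpow_atTop hκ0
  obtain ⟨L, ⟨hL1, hL2⟩, hL3⟩ := (((ht.eventually_gt_atTop (D / c1)).and
    (eventually_ge_atTop 1)).and (eventually_ge_atTop L0)).exists
  have hL0 : 0 < L := by linarith
  obtain ⟨l, hl, h⟩ := H L hL3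
  set V := l^(m+1) * L with hV
  have hV0 : 0 < V := by positivity
  set T := l^2 * L^2 with hT
  have hT0 : 0 < T := by positivity
  have e1 : T ^ (1/p) * V ^ (1/q) = L ^ κ * V ^ ((1:ℝ)/2) := by
    apply Real.log_injOn_pos (Set.mem_Ioi.2 (by positivity)) (Set.mem_Ioi.2 (by positivity))
    rw [Real.log_mul (by positivity) (by positivity), Real.log_mul (by positivity) (by positivity),
      Real.log_rpow hT0, Real.log_rpow hV0, Real.log_rpow hV0, Real.log_rpow hL0, hT, hV,
      Real.log_mul (by positivity) (by positivity), Real.log_mul (by positivity) (by positivity),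
      Real.log_pow, Real.log_pow, Real.log_pow, hκ]
    push_cast
    linear_combination (Real.log l + Real.log L) * he
  have e2 : T ^ (1/(p/(p-1))) * T⁻¹ * V ^ (1/(q/(q-1))) * (T ^ (1/p) * V ^ (1/q)) = V := by
    have x1 : 1/(p/(p-1)) = 1 - 1/p := by field_simp
    have x2 : 1/(q/(q-1)) = 1 - 1/q := by field_simp
    rw [x1, x2, Real.rpow_sub hT0, Real.rpow_sub hV0, Real.rpow_one, Real.rpow_one]
    field_simp
  have hVh : V = V ^ ((1:ℝ)/2) * V ^ ((1:ℝ)/2) := by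
    rw [← Real.rpow_add hV0]; norm_num
  have hVp : 0 < V ^ ((1:ℝ)/2) := by positivity
  have hLk : 1 ≤ L ^ κ := Real.one_le_rpow hL2 hκ0.le
  have e3 : T ^ (1/(p/(p-1))) * T⁻¹ * V ^ (1/(q/(q-1))) ≤ V ^ ((1:ℝ)/2) := by
    have hx : 0 < T ^ (1/(p/(p-1))) * T⁻¹ * V ^ (1/(q/(q-1))) := by positivity
    set X := T ^ (1/(p/(p-1))) * T⁻¹ * V ^ (1/(q/(q-1)))
    rw [e1] at e2
    have : X * L ^ κ = V ^ ((1:ℝ)/2) := by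
      apply mul_right_cancel₀ hVp.ne'
      linear_combination e2 + hVh
    nlinarith
  rw [Real.mul_rpow hc2.le hV0.le, Real.mul_rpow hc3.le hV0.le] at h
  have h2 : c1 * L ^ κ * V ^ ((1:ℝ)/2) ≤ D * V ^ ((1:ℝ)/2) := by
    calc c1 * L ^ κ * V ^ ((1:ℝ)/2) = T ^ (1/p) * (c1 * V ^ (1/q)) := by
          linear_combination (-c1) * e1
      _ ≤ _ := h
      _ = C * (d2 * c2 ^ ((1:ℝ)/2) * V ^ ((1:ℝ)/2) + d3 * c3 ^ (1/(q/(q-1))) *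
            (T ^ (1/(p/(p-1))) * T⁻¹ * V ^ (1/(q/(q-1))))) := by ring
      _ ≤ C * (d2 * c2 ^ ((1:ℝ)/2) * V ^ ((1:ℝ)/2) + d3 * c3 ^ (1/(q/(q-1))) *
            V ^ ((1:ℝ)/2)) := by gcongr
      _ = D * V ^ ((1:ℝ)/2) := by rw [hD]; ring
  have h3 := le_of_mul_le_mul_right h2 hVp
  rw [div_lt_iff₀ hc1] at hL1
  linarith

/-- Strichartz estimates fail for the magnetic Schrödinger equation with potential
`A(x) = |x|^{-α} M x`, `1 < α < 2`, in odd dimension `n ≥ 3`. -/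
theorem no_strichartz_odd (n : ℕ) (hn : 3 ≤ n) (hodd : Odd n)
    (α : ℝ) (hα1 : 1 < α) (hα2 : α < 2)
    (p q : ℝ) (hpq : SAdmissible n p q) :
    ¬ ∃ C : ℝ, 0 < C ∧ ∀ T : ℝ, 0 < T → ∀ u : ℝ → (Fin n → ℝ) → ℂ,
        ContDiff ℝ (⊤ : ℕ∞) (fun pr : ℝ × (Fin n → ℝ) => u pr.1 pr.2) →
        (∃ K : Set (Fin n → ℝ), IsCompact K ∧ (0 : Fin n → ℝ) ∉ K ∧
          ∀ t x, x ∉ K → u t x = 0) →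
        mixedNorm p q T u ≤
          C * ((eLpNorm (u 0) 2 volume).toReal
            + mixedNorm (p / (p-1)) (q / (q-1)) T (schroedResid n (n-1) α u)) := by
  obtain ⟨m, rfl⟩ : ∃ m, n = m + 1 := ⟨n - 1, by omega⟩
  rintro ⟨C, hC, H⟩
  have hm : Even m := by
    rcases Nat.even_or_odd m with h | h
    · exact h
    · exact absurd h.add_one (Nat.not_even_iff_odd.2 hodd)
  rw [Nat.add_sub_cancel] at H
  obtain ⟨φ, φ1, φ2, B, hB, h1, h2, h3, h4, h5, h6⟩ := exists_cutoff
  have hq1 : 0 < q / (q-1) := by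
    have := hpq.2.1
    apply div_pos <;> linarith
  exact final_contra m (by omega) p q (Real.exp (-m/2)) (cst m 2) (cst m (q/(q-1))) B
    (B * (2 * m + 26)) C hpq (Real.exp_pos _) (cst_pos m 2 (by norm_num)) (cst_pos m _ hq1)
    (by linarith) (by positivity) hC (4 * m + 1)
    (fun L hL => key_ineq m hm α hα2 p q hpq.1 hpq.2.1 φ φ1 φ2 B hB h1 h2 h3 h4 h5 h6 C hC H L hL)
end
end

section
/- Let q ∈ [1,∞), let L ∈ ⋂_{1≤p<∞} L^p(ℝ^{n−1}) with L not almost everywhere zero, and set Λ(y,z) := L(y/z^{α/2}) for y ∈ ℝ^{n−1}, z > 0. Then there exist constants c, C > 0 and R₀ > 2 such that for all R ≥ R₀: c·R^{(α(n−1)+2γ)/(2q)} ≤ ‖Λ(y,z)·ψ_R(z)·ψ(|y|²/z²)‖_{L^q({(y,z) ∈ ℝ^{n−1}×(0,∞)})} ≤ C·R^{(α(n−1)+2γ)/(2q)}. -/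
open MeasureTheory Filter

noncomputable section

/-- Rescaled eigenfunction `ω(y,z) = v(y / z^(α/2))`. -/
def omegaFn (m : ℕ) (α : ℝ) (v : (Fin m → ℝ) → ℂ) (x : (Fin m → ℝ) × ℝ) : ℂ :=
  v fun i => x.1 i / x.2 ^ (α/2)

/-- `W(t,y,z) = e^{iλt/z^α} ω(y,z)`. -/
def Wfun (m : ℕ) (α lam : ℝ) (v : (Fin m → ℝ) → ℂ) (t : ℝ)
    (x : (Fin m → ℝ) × ℝ) : ℂ :=
  Complex.exp (Complex.I * ((lam * t / x.2 ^ α : ℝ) : ℂ)) * omegaFn m α v x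

/-- `ψ_R(z) = ψ((z - R)/R^γ)`. -/
def psiR (ψ : ℝ → ℝ) (γ R z : ℝ) : ℝ := ψ ((z - R) / R ^ γ)

/-- `W_R(t,y,z) = W(t,y,z) ψ_R(z) ψ(|y|²/z²)` for `z > 0`, extended by `0` for `z ≤ 0`. -/
def WRfun (m : ℕ) (α lam : ℝ) (v : (Fin m → ℝ) → ℂ) (ψ : ℝ → ℝ) (γ R : ℝ)
    (t : ℝ) (x : (Fin m → ℝ) × ℝ) : ℂ :=
  if 0 < x.2 then
    Wfun m α lam v t x * ((psiR ψ γ R x.2 : ℝ) : ℂ)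
      * ((ψ (euclNorm x.1 ^ 2 / x.2 ^ 2) : ℝ) : ℂ)
  else 0

/-- Initial datum `f_R = W_R(0,·)`. -/
def fRfun (m : ℕ) (α lam : ℝ) (v : (Fin m → ℝ) → ℂ) (ψ : ℝ → ℝ) (γ R : ℝ) :
    (Fin m → ℝ) × ℝ → ℂ :=
  WRfun m α lam v ψ γ R 0

/-- Partial derivative in the `i`-th `y` direction on `(Fin m → ℝ) × ℝ`. -/
def pdY {m : ℕ} (f : (Fin m → ℝ) × ℝ → ℂ) (i : Fin m)
    (x : (Fin m → ℝ) × ℝ) : ℂ :=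
  fderiv ℝ f x (Pi.single i 1, 0)

/-- Partial derivative in the `z` direction on `(Fin m → ℝ) × ℝ`. -/
def pdZ {m : ℕ} (f : (Fin m → ℝ) × ℝ → ℂ) (x : (Fin m → ℝ) × ℝ) : ℂ :=
  fderiv ℝ f x (0, 1)

/-- Full spatial Laplacian on `(Fin m → ℝ) × ℝ ≃ ℝⁿ`. -/
def lapX {m : ℕ} (f : (Fin m → ℝ) × ℝ → ℂ) (x : (Fin m → ℝ) × ℝ) : ℂ :=
  (∑ i, pdY (pdY f i) i x) + pdZ (pdZ f) x

/-- Divergence of a vector field on `(Fin m → ℝ) × ℝ`. -/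
def divX {m : ℕ} (b : (Fin m → ℝ) × ℝ → (Fin m → ℝ) × ℝ)
    (x : (Fin m → ℝ) × ℝ) : ℝ :=
  (∑ i, fderiv ℝ (fun x' => (b x').1 i) x (Pi.single i 1, 0))
    + fderiv ℝ (fun x' => (b x').2) x (0, 1)

/-- `a · ∇u` for a (constant at `x`) vector `a` on `(Fin m → ℝ) × ℝ`. -/
def dotGrad {m : ℕ} (a : (Fin m → ℝ) × ℝ) (u : (Fin m → ℝ) × ℝ → ℂ)
    (x : (Fin m → ℝ) × ℝ) : ℂ :=
  (∑ i, ((a.1 i : ℝ) : ℂ) * pdY u i x) + ((a.2 : ℝ) : ℂ) * pdZ u x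

/-- Squared Euclidean length of a vector of `(Fin m → ℝ) × ℝ`. -/
def normSqPair {m : ℕ} (a : (Fin m → ℝ) × ℝ) : ℝ := euclNorm a.1 ^ 2 + a.2 ^ 2

/-- Magnetic operator `(∇ - ia)² u = Δu - 2i a·∇u - i (div a) u - |a|² u`. -/
def magSq {m : ℕ} (a : (Fin m → ℝ) × ℝ → (Fin m → ℝ) × ℝ)
    (u : (Fin m → ℝ) × ℝ → ℂ) (x : (Fin m → ℝ) × ℝ) : ℂ :=
  lapX u x - 2 * Complex.I * dotGrad (a x) u x - Complex.I * ((divX a x : ℝ) : ℂ) * u x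
    - ((normSqPair (a x) : ℝ) : ℂ) * u x

/-- The vector field `z^{-α} M(y,0)ᵗ = z^{-α} (Ω_m y, 0)`. -/
def aZ (m : ℕ) (α : ℝ) (x : (Fin m → ℝ) × ℝ) : (Fin m → ℝ) × ℝ :=
  (fun i => x.2 ^ (-α) * (omegaMat m).mulVec x.1 i, 0)

/-- `F_R = i ∂_t W_R - (∇ - i z^{-α} M(y,0)ᵗ)² W_R`. -/
def FRfun (m : ℕ) (α lam : ℝ) (v : (Fin m → ℝ) → ℂ) (ψ : ℝ → ℝ) (γ R : ℝ)
    (t : ℝ) (x : (Fin m → ℝ) × ℝ) : ℂ :=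
  Complex.I * deriv (fun s => WRfun m α lam v ψ γ R s x) t
    - magSq (aZ m α) (WRfun m α lam v ψ γ R t) x

/-- Euclidean norm of `x = (y,z) ∈ ℝ^{n-1} × ℝ`. -/
def pairNorm {m : ℕ} (x : (Fin m → ℝ) × ℝ) : ℝ :=
  Real.sqrt (euclNorm x.1 ^ 2 + x.2 ^ 2)

/-- The magnetic potential `A(x) = |x|^{-α} M x = |x|^{-α} (Ω_m y, 0)` in split
coordinates `x = (y, z)`. -/
def Asplit (m : ℕ) (α : ℝ) (x : (Fin m → ℝ) × ℝ) : (Fin m → ℝ) × ℝ :=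
  (fun i => pairNorm x ^ (-α) * (omegaMat m).mulVec x.1 i, 0)

/-- Residual `i ∂_t u - Δu + 2i A·∇u + |A|² u` of the magnetic Schrödinger equation. -/
def residOp (m : ℕ) (α : ℝ) (u : ℝ → (Fin m → ℝ) × ℝ → ℂ) (t : ℝ)
    (x : (Fin m → ℝ) × ℝ) : ℂ :=
  Complex.I * deriv (fun s => u s x) t - lapX (u t) x
    + 2 * Complex.I * dotGrad (Asplit m α x) (u t) x
    + ((normSqPair (Asplit m α x) : ℝ) : ℂ) * u t x

/-- Time-truncated residual `F̃_R = 1_{(0,R^β)}(t) (i ∂_t W_R - ΔW_R + 2i A·∇W_R + |A|² W_R)`. -/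
def FtildeR (m : ℕ) (α lam : ℝ) (v : (Fin m → ℝ) → ℂ) (ψ : ℝ → ℝ)
    (γ R β : ℝ) (t : ℝ) (x : (Fin m → ℝ) × ℝ) : ℂ :=
  if 0 < t ∧ t < R ^ β then residOp m α (WRfun m α lam v ψ γ R) t x else 0


lemma slab_scale {m : ℕ} (s : ℝ) (hs : 0 < s) (H : (Fin m → ℝ) → ENNReal) (hH : Measurable H) :
    ∫⁻ y : Fin m → ℝ, H (fun i => y i / s) = ENNReal.ofReal (s ^ m) * ∫⁻ y, H y := by
  have h := Measure.map_addHaar_smul (volume : Measure (Fin m → ℝ)) (r := s⁻¹) (inv_ne_zero hs.ne')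
  have h2 : ∫⁻ y : Fin m → ℝ, H (fun i => y i / s) = ∫⁻ y : Fin m → ℝ, H (s⁻¹ • y) := by
    congr 1; ext y; congr 1; ext i; simp [div_eq_inv_mul]
  rw [h2, ← lintegral_map (f := H) hH (measurable_const_smul (s⁻¹)), h, lintegral_smul_measure]
  simp [abs_of_pos hs]

lemma slab_meas {m : ℕ} (a : ℝ) :
    Measurable (fun x : (Fin m → ℝ) × ℝ => (fun i => x.1 i / x.2 ^ a : Fin m → ℝ)) := by
  apply measurable_pi_lambda
  intro i
  fun_prop

lemma slab_set {m : ℕ} {S : Set ℝ} (hS : MeasurableSet S) :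
    MeasurableSet {x : (Fin m → ℝ) × ℝ | x.2 ∈ S} := measurable_snd hS

lemma slab_int {m : ℕ} (a : ℝ) (S : Set ℝ) (hS : MeasurableSet S) (hS0 : ∀ z ∈ S, 0 < z)
    (H : (Fin m → ℝ) → ENNReal) (hH : Measurable H) :
    ∫⁻ x in {x : (Fin m → ℝ) × ℝ | x.2 ∈ S}, H (fun i => x.1 i / x.2 ^ a)
      = ∫⁻ z in S, ENNReal.ofReal ((z ^ a) ^ m) * ∫⁻ y, H y := by
  rw [← lintegral_indicator (slab_set hS), Measure.volume_eq_prod, lintegral_prod_symm',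
    ← lintegral_indicator hS]
  · congr 1; ext z
    by_cases hz : z ∈ S
    · simp only [Set.indicator, Set.mem_ofPred_eq, hz, if_true]
      exact slab_scale _ (Real.rpow_pos_of_pos (hS0 z hz) a) H hH
    · simp [Set.indicator, hz]
  · exact (hH.comp (slab_meas a)).indicator (slab_set hS)

lemma slab_ae {m : ℕ} (a : ℝ) (L L' : (Fin m → ℝ) → ℂ) (h : L =ᵐ[volume] L') :
    ∀ᵐ x ∂(volume.restrict {x : (Fin m → ℝ) × ℝ | 0 < x.2}),
      L (fun i => x.1 i / x.2 ^ a) = L' (fun i => x.1 i / x.2 ^ a) := by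
  obtain ⟨N, hN, hNm, hN0⟩ := exists_measurable_superset_of_null (ae_iff.1 h)
  have hm : Measurable (N.indicator (1 : (Fin m → ℝ) → ENNReal)) := measurable_one.indicator hNm
  have := slab_int a (Set.Ioi 0) measurableSet_Ioi (fun z hz => hz) _ hm
  rw [lintegral_indicator_one hNm, hN0] at this
  simp only [mul_zero, lintegral_zero] at this
  have h3 := (lintegral_eq_zero_iff (hm.comp (slab_meas a))).1 this
  filter_upwards [h3] with x hx
  by_contra hne
  have : (fun i => x.1 i / x.2 ^ a) ∈ N := hN hne
  simp [Function.comp, this] at hx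

lemma euclNorm_meas {m : ℕ} : Measurable (euclNorm : (Fin m → ℝ) → ℝ) := by
  unfold euclNorm; fun_prop

lemma exists_ball {m : ℕ} (G : (Fin m → ℝ) → ENNReal) (hG : Measurable G)
    (h0 : ¬ ∀ᵐ y, G y = 0) :
    ∃ r : ℕ, ∫⁻ y, ({y : Fin m → ℝ | euclNorm y < r}).indicator G y ≠ 0 := by
  by_contra hc
  push Not at hc
  apply h0
  have hms : ∀ r : ℕ, MeasurableSet {y : Fin m → ℝ | euclNorm y < r} := fun r =>
    measurableSet_lt euclNorm_meas measurable_const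
  have h1 := ae_all_iff.2 fun r : ℕ => (lintegral_eq_zero_iff (hG.indicator (hms r))).1 (hc r)
  filter_upwards [h1] with y hy
  obtain ⟨r, hr⟩ := exists_nat_gt (euclNorm y)
  have := hy r
  simpa [Set.indicator, hr] using this

lemma slab_main {m : ℕ} (α : ℝ) (hα1 : 1 < α) (hα2 : α < 2)
    (ψ : ℝ → ℝ) (hψ : IsCutoff ψ) (γ : ℝ) (hγ1 : 1/2 < γ) (hγ2 : γ < 1)
    (q : ℝ) (hq : 1 ≤ q) (L : (Fin m → ℝ) → ℂ) (hLm : Measurable L)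
    (hP : ∫⁻ y, ‖L y‖ₑ ^ q ≠ ⊤)
    (hL0 : ¬ ∀ᵐ y ∂(volume : Measure (Fin m → ℝ)), L y = 0) :
    ∃ c C R₀ : ℝ, 0 < c ∧ 0 < C ∧ 2 < R₀ ∧ ∀ R : ℝ, R₀ ≤ R →
      ENNReal.ofReal (c * R ^ (α / 2 * m + γ)) ≤
          ∫⁻ x in {x : (Fin m → ℝ) × ℝ | 0 < x.2},
            ‖L (fun i => x.1 i / x.2 ^ (α/2)) * ((psiR ψ γ R x.2 : ℝ) : ℂ)
                * ((ψ (euclNorm x.1 ^ 2 / x.2 ^ 2) : ℝ) : ℂ)‖ₑ ^ q ∧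
        ∫⁻ x in {x : (Fin m → ℝ) × ℝ | 0 < x.2},
            ‖L (fun i => x.1 i / x.2 ^ (α/2)) * ((psiR ψ γ R x.2 : ℝ) : ℂ)
                * ((ψ (euclNorm x.1 ^ 2 / x.2 ^ 2) : ℝ) : ℂ)‖ₑ ^ q ≤
          ENNReal.ofReal (C * R ^ (α / 2 * m + γ)) := by
  obtain ⟨-, -, h01, hz, h1⟩ := hψ
  have hq0 : 0 < q := by linarith
  have hGm : Measurable (fun y => ‖L y‖ₑ ^ q) := hLm.enorm.pow_const q
  obtain ⟨r, hr⟩ := exists_ball (fun y => ‖L y‖ₑ ^ q) hGm (by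
    intro h; apply hL0; filter_upwards [h] with y hy
    simpa [ENNReal.rpow_eq_zero_iff, hq0, hq0.le.not_gt] using hy)
  set B : Set (Fin m → ℝ) := {y | euclNorm y < r} with hB
  have hBm : MeasurableSet B := measurableSet_lt euclNorm_meas measurable_const
  set P := ∫⁻ y, ‖L y‖ₑ ^ q with hPd
  set K := ∫⁻ y, B.indicator (fun y => ‖L y‖ₑ ^ q) y with hKd
  have hKP : K ≤ P := lintegral_mono fun y => Set.indicator_le_self _ _ y
  have hKt : K ≠ ⊤ := ne_top_of_le_ne_top hP hKP
  have hK0 : 0 < K.toReal := ENNReal.toReal_pos hr hKt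
  have hP0 : 0 < P.toReal := lt_of_lt_of_le hK0 (ENNReal.toReal_mono hP hKP)
  obtain ⟨X, hX⟩ := eventually_atTop.1 (((tendsto_rpow_neg_atTop (y := 2 - α) (by linarith)).const_mul
    ((r:ℝ)^2)).eventually_lt_const (u := (1/2:ℝ)) (by norm_num))
  have ha0 : 0 ≤ α / 2 := by linarith
  refine ⟨((1/2)^(α/2))^m * K.toReal, (2^(α/2))^m * 2 * P.toReal, max 3 (2 * X),
    by positivity, by positivity, lt_of_lt_of_le (by norm_num) (le_max_left _ _), ?_⟩
  intro R hR
  have hR3 : 3 ≤ R := (le_max_left _ _).trans hR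
  have hRX : 2 * X ≤ R := (le_max_right _ _).trans hR
  have hRp : 0 < R := by linarith
  have hRg : R ^ γ ≤ R := by
    simpa using Real.rpow_le_rpow_of_exponent_le (x := R) (by linarith) hγ2.le
  have hRg0 : 0 < R ^ γ := Real.rpow_pos_of_pos hRp _
  have hpow : ∀ t : ℝ, 0 < t → ((t * R) ^ (α/2))^m * R ^ γ = (t^(α/2))^m * R ^ (α/2*m+γ) := by
    intro t ht
    rw [Real.mul_rpow ht.le hRp.le, mul_pow, Real.rpow_add hRp, Real.rpow_mul hRp.le,
      Real.rpow_natCast, mul_assoc]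
  constructor
  · -- lower bound
    set S : Set ℝ := Set.Ioo (R - R^γ/2) (R + R^γ/2) with hS
    have hS0 : ∀ z ∈ S, R / 2 < z := fun z hz => by have := hz.1; linarith
    calc ENNReal.ofReal (((1/2)^(α/2))^m * K.toReal * R ^ (α / 2 * m + γ))
        = ENNReal.ofReal (((1/2*R)^(α/2))^m) * K * ENNReal.ofReal (R ^ γ) := by
          rw [mul_right_comm, ← hpow _ (by norm_num), ENNReal.ofReal_mul (by positivity),
            ENNReal.ofReal_mul (by positivity), ENNReal.ofReal_toReal hKt, mul_right_comm]
      _ = ∫⁻ z in S, ENNReal.ofReal (((1/2*R)^(α/2))^m) * K := by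
          rw [setLIntegral_const, hS, Real.volume_Ioo]; congr 2; ring
      _ ≤ ∫⁻ z in S, ENNReal.ofReal ((z ^ (α/2)) ^ m) * K := by
          apply setLIntegral_mono' measurableSet_Ioo
          intro z hz
          have := hS0 z hz
          gcongr
          linarith
      _ = ∫⁻ x in {x : (Fin m → ℝ) × ℝ | x.2 ∈ S},
            B.indicator (fun y => ‖L y‖ₑ ^ q) (fun i => x.1 i / x.2 ^ (α/2)) :=
          (slab_int _ S measurableSet_Ioo (fun z hz => by have := hS0 z hz; linarith) _
            (hGm.indicator hBm)).symm
      _ ≤ ∫⁻ x in {x : (Fin m → ℝ) × ℝ | x.2 ∈ S},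
            ‖L (fun i => x.1 i / x.2 ^ (α/2)) * ((psiR ψ γ R x.2 : ℝ) : ℂ)
                * ((ψ (euclNorm x.1 ^ 2 / x.2 ^ 2) : ℝ) : ℂ)‖ₑ ^ q := by
          apply setLIntegral_mono' (slab_set measurableSet_Ioo)
          rintro ⟨y, z⟩ hzS
          replace hzS : z ∈ S := hzS
          have hzR := hS0 z hzS
          have hz0 : 0 < z := by linarith
          by_cases hy : (fun i => y i / z ^ (α/2)) ∈ B
          · rw [Set.indicator_of_mem hy]
            have e1 : psiR ψ γ R z = 1 := by
              apply h1
              rw [abs_div, abs_of_pos hRg0, div_lt_iff₀ hRg0, abs_lt]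
              constructor <;> [have := hzS.1; have := hzS.2] <;> linarith
            have e2 : ψ (euclNorm y ^ 2 / z ^ 2) = 1 := by
              apply h1
              rw [abs_of_nonneg (by positivity)]
              have hs : 0 < z ^ (α/2) := Real.rpow_pos_of_pos hz0 _
              have hyB : euclNorm (fun i => y i / z ^ (α/2)) < r := hy
              have e3 : euclNorm (fun i => y i / z ^ (α/2)) ^ 2 = euclNorm y ^ 2 / z ^ α := by
                unfold euclNorm
                rw [Real.sq_sqrt (by positivity), Real.sq_sqrt (by positivity), Finset.sum_div]
                refine Finset.sum_congr rfl fun i _ => ?_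
                rw [div_pow, ← Real.rpow_natCast (z ^ (α/2)), ← Real.rpow_mul hz0.le]
                norm_num
              have e4 : euclNorm y ^ 2 / z ^ α ≤ (r:ℝ)^2 := by
                rw [← e3]
                exact pow_le_pow_left₀ (Real.sqrt_nonneg _) hyB.le 2
              have e5 := hX z (by linarith)
              have e6 : euclNorm y ^ 2 / z ^ 2 = euclNorm y ^ 2 / z ^ α * z ^ (-(2-α)) := by
                rw [neg_sub, Real.rpow_sub hz0, Real.rpow_two]
                have : 0 < z ^ α := Real.rpow_pos_of_pos hz0 _
                field_simp
              rw [e6]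
              refine lt_of_le_of_lt ?_ e5
              gcongr
            simp [e1, e2]
          · rw [Set.indicator_of_notMem hy]; exact zero_le
      _ ≤ _ := by
          apply lintegral_mono_set
          intro x hx
          have := hS0 x.2 hx
          show 0 < x.2
          linarith
  · set S : Set ℝ := Set.Ioc 0 (2*R) ∩ Set.Icc (R - R^γ) (R + R^γ) with hS
    have hSm : MeasurableSet S := measurableSet_Ioc.inter measurableSet_Icc
    calc _ ≤ ∫⁻ x in {x : (Fin m → ℝ) × ℝ | 0 < x.2},
            {x : (Fin m → ℝ) × ℝ | x.2 ∈ S}.indicator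
              (fun x => ‖L (fun i => x.1 i / x.2 ^ (α/2))‖ₑ ^ q) x := by
          apply setLIntegral_mono' (slab_set measurableSet_Ioi)
          rintro ⟨y, z⟩ hz0
          replace hz0 : 0 < z := hz0
          by_cases hzS : z ∈ S
          · rw [Set.indicator_of_mem (by exact hzS)]
            have key : ∀ s, ‖((ψ s : ℝ) : ℂ)‖ₑ ≤ 1 := by
              intro s
              rw [← ofReal_norm, Complex.norm_real, Real.norm_of_nonneg (h01 s).1]
              simpa using (h01 s).2
            gcongr
            rw [enorm_mul, enorm_mul]
            calc _ ≤ ‖L (fun i => y i / z ^ (α/2))‖ₑ * 1 * 1 := by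
                  gcongr
                  · exact key _
                  · exact key _
              _ = _ := by simp
          · have e1 : psiR ψ γ R z = 0 := by
              apply hz
              rw [abs_div, abs_of_pos hRg0, lt_div_iff₀ hRg0, one_mul]
              by_contra hcon
              rw [not_lt, abs_le] at hcon
              exact hzS ⟨⟨hz0, by linarith⟩, by linarith, by linarith⟩
            simp [e1, hq0]
      _ ≤ ∫⁻ x, {x : (Fin m → ℝ) × ℝ | x.2 ∈ S}.indicator
              (fun x => ‖L (fun i => x.1 i / x.2 ^ (α/2))‖ₑ ^ q) x := setLIntegral_le_lintegral _ _
      _ = ∫⁻ x in {x : (Fin m → ℝ) × ℝ | x.2 ∈ S},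
              ‖L (fun i => x.1 i / x.2 ^ (α/2))‖ₑ ^ q := lintegral_indicator (slab_set hSm) _
      _ = ∫⁻ z in S, ENNReal.ofReal ((z ^ (α/2)) ^ m) * P :=
          slab_int _ S hSm (fun z hz => hz.1.1) _ hGm
      _ ≤ ∫⁻ z in S, ENNReal.ofReal (((2*R)^(α/2))^m) * P := by
          apply setLIntegral_mono' hSm
          intro z hz
          have := hz.1.1
          have := hz.1.2
          gcongr
      _ = ENNReal.ofReal (((2*R)^(α/2))^m) * P * volume S := setLIntegral_const _ _
      _ ≤ ENNReal.ofReal (((2*R)^(α/2))^m) * P * ENNReal.ofReal (2 * R ^ γ) := by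
          gcongr
          refine (measure_mono Set.inter_subset_right).trans ?_
          rw [Real.volume_Icc]
          apply le_of_eq; congr 1; ring
      _ = _ := by
          have : (2^(α/2))^m * 2 * P.toReal * R ^ (α / 2 * m + γ)
            = ((2*R)^(α/2))^m * P.toReal * (2 * R ^ γ) := by
            linear_combination (-2 * P.toReal) * hpow 2 (by norm_num)
          rw [this, ENNReal.ofReal_mul (p := ((2*R)^(α/2))^m * P.toReal) (by positivity),
            ENNReal.ofReal_mul (p := ((2*R)^(α/2))^m) (by positivity), ENNReal.ofReal_toReal hP]

/-- Two-sided `L^q` bound for `Λ ψ_R ψ`, where `Λ(y,z) = L(y/z^{α/2})`. -/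
theorem lambda_cutoff_norm (n : ℕ) (hn : 3 ≤ n) (hodd : Odd n)
    (α : ℝ) (hα1 : 1 < α) (hα2 : α < 2)
    (ψ : ℝ → ℝ) (hψ : IsCutoff ψ) (γ : ℝ) (hγ1 : 1/2 < γ) (hγ2 : γ < 1)
    (q : ℝ) (hq : 1 ≤ q)
    (L : (Fin (n-1) → ℝ) → ℂ)
    (hL : ∀ p : ℝ, 1 ≤ p → MemLp L (ENNReal.ofReal p) volume)
    (hL0 : ¬ ∀ᵐ y ∂(volume : Measure (Fin (n-1) → ℝ)), L y = 0) :
    ∃ c C R₀ : ℝ, 0 < c ∧ 0 < C ∧ 2 < R₀ ∧ ∀ R : ℝ, R₀ ≤ R →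
      c * R ^ ((α * ((n:ℝ) - 1) + 2*γ) / (2*q)) ≤
          (eLpNorm (fun x : (Fin (n-1) → ℝ) × ℝ =>
              L (fun i => x.1 i / x.2 ^ (α/2)) * ((psiR ψ γ R x.2 : ℝ) : ℂ)
                * ((ψ (euclNorm x.1 ^ 2 / x.2 ^ 2) : ℝ) : ℂ))
            (ENNReal.ofReal q)
            (volume.restrict {x : (Fin (n-1) → ℝ) × ℝ | 0 < x.2})).toReal ∧
        (eLpNorm (fun x : (Fin (n-1) → ℝ) × ℝ =>
              L (fun i => x.1 i / x.2 ^ (α/2)) * ((psiR ψ γ R x.2 : ℝ) : ℂ)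
                * ((ψ (euclNorm x.1 ^ 2 / x.2 ^ 2) : ℝ) : ℂ))
            (ENNReal.ofReal q)
            (volume.restrict {x : (Fin (n-1) → ℝ) × ℝ | 0 < x.2})).toReal ≤
          C * R ^ ((α * ((n:ℝ) - 1) + 2*γ) / (2*q)) := by
  have hq0 : 0 < q := by linarith
  have hLae := (hL q hq).1
  set L' := hLae.mk L with hL'
  have hLL : L =ᵐ[volume] L' := hLae.ae_eq_mk
  have hqn : ENNReal.ofReal q ≠ 0 := by simpa using hq0
  have hP : ∫⁻ y, ‖L' y‖ₑ ^ q ≠ ⊤ := by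
    have h := ((memLp_congr_ae hLL).1 (hL q hq)).2
    have h2 := (lintegral_rpow_enorm_lt_top_of_eLpNorm_lt_top hqn ENNReal.ofReal_ne_top h).ne
    rwa [ENNReal.toReal_ofReal hq0.le] at h2
  obtain ⟨c, C, R₀, hc, hC, hR0, H⟩ := slab_main α hα1 hα2 ψ hψ γ hγ1 hγ2 q hq L'
    hLae.stronglyMeasurable_mk.measurable hP (by
      intro h; apply hL0; filter_upwards [h, hLL] with y h1 h2; rw [h2, h1])
  refine ⟨c ^ (1/q), C ^ (1/q), R₀, by positivity, by positivity, hR0, ?_⟩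
  intro R hR
  have hRp : 0 < R := by linarith
  obtain ⟨h1, h2⟩ := H R hR
  have hcast : ((n - 1 : ℕ) : ℝ) = (n : ℝ) - 1 := by
    rw [Nat.cast_sub (by omega)]; simp
  rw [hcast] at h1 h2
  have hexp : ∀ d : ℝ, 0 < d → (d * R ^ (α / 2 * ((n:ℝ) - 1) + γ)) ^ (1/q)
      = d ^ (1/q) * R ^ ((α * ((n:ℝ) - 1) + 2*γ) / (2*q)) := by
    intro d hd
    rw [Real.mul_rpow hd.le (by positivity), ← Real.rpow_mul hRp.le]
    congr 2
    field_simp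
  have hcongr : (fun x : (Fin (n-1) → ℝ) × ℝ =>
              L (fun i => x.1 i / x.2 ^ (α/2)) * ((psiR ψ γ R x.2 : ℝ) : ℂ)
                * ((ψ (euclNorm x.1 ^ 2 / x.2 ^ 2) : ℝ) : ℂ))
      =ᵐ[volume.restrict {x : (Fin (n-1) → ℝ) × ℝ | 0 < x.2}] (fun x : (Fin (n-1) → ℝ) × ℝ =>
              L' (fun i => x.1 i / x.2 ^ (α/2)) * ((psiR ψ γ R x.2 : ℝ) : ℂ)
                * ((ψ (euclNorm x.1 ^ 2 / x.2 ^ 2) : ℝ) : ℂ)) := by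
    filter_upwards [slab_ae (α/2) L L' hLL] with x hx
    rw [hx]
  rw [eLpNorm_congr_ae hcongr, eLpNorm_eq_lintegral_rpow_enorm_toReal hqn ENNReal.ofReal_ne_top,
    ENNReal.toReal_ofReal hq0.le, ← ENNReal.toReal_rpow, ← hexp c hc, ← hexp C hC]
  have hfin := ne_top_of_le_ne_top ENNReal.ofReal_ne_top h2
  constructor
  · apply Real.rpow_le_rpow (by positivity) _ (by positivity)
    exact (ENNReal.ofReal_le_iff_le_toReal hfin).1 h1
  · apply Real.rpow_le_rpow (by positivity) _ (by positivity)
    exact ENNReal.toReal_le_of_le_ofReal (by positivity) h2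
end
end

section
/- There exists a constant C > 0 (independent of R) such that ‖f_R‖_{L²(ℝⁿ)} ≤ C·R^{(α(n−1)+2γ)/4} for all R > 2. -/
open MeasureTheory Filter

noncomputable section

theorem aux_scale (m : ℕ) (v : (Fin m → ℝ) → ℂ) (hv : Continuous v) (c : ℝ) (hc : 0 < c) :
    ∫⁻ y : Fin m → ℝ, ‖v fun i => y i / c‖ₑ ^ (2:ℝ) =
      ENNReal.ofReal (c ^ m) * ∫⁻ y, ‖v y‖ₑ ^ (2:ℝ) := by
  have hmeas : Measurable fun y => ‖v y‖ₑ ^ (2:ℝ) := hv.measurable.enorm.pow_const _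
  have h := Measure.map_addHaar_smul (volume : Measure (Fin m → ℝ)) (inv_ne_zero hc.ne')
  have h2 : ∫⁻ y, ‖v y‖ₑ ^ (2:ℝ) ∂(Measure.map (c⁻¹ • ·) (volume : Measure (Fin m → ℝ))) =
      ∫⁻ y : Fin m → ℝ, ‖v (c⁻¹ • y)‖ₑ ^ (2:ℝ) :=
    lintegral_map hmeas (measurable_const_smul _)
  rw [h, lintegral_smul_measure] at h2
  have h3 : ∀ y : Fin m → ℝ, (fun i => y i / c) = c⁻¹ • y := by
    intro y; ext i; simp [div_eq_inv_mul]
  simp_rw [h3]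
  rw [← h2]
  simp [abs_of_pos hc]

theorem aux_pt (m : ℕ) (α lam : ℝ) (v : (Fin m → ℝ) → ℂ) (ψ : ℝ → ℝ) (hψ : IsCutoff ψ)
    (γ R : ℝ) (hR : 0 < R) (x : (Fin m → ℝ) × ℝ) :
    ‖fRfun m α lam v ψ γ R x‖ₑ ^ (2:ℝ) ≤
      (Set.Icc (R - R ^ γ) (R + R ^ γ)).indicator 1 x.2 * ‖omegaFn m α v x‖ₑ ^ (2:ℝ) := by
  obtain ⟨-, -, h01, h0, -⟩ := hψ
  have hRg : 0 < R ^ γ := Real.rpow_pos_of_pos hR γ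
  by_cases hx : x.2 ∈ Set.Icc (R - R ^ γ) (R + R ^ γ)
  · rw [Set.indicator_of_mem hx, Pi.one_apply, one_mul]
    refine ENNReal.rpow_le_rpow ?_ (by norm_num)
    rw [enorm_le_iff_norm_le]
    unfold fRfun WRfun
    split_ifs
    · have e : ∀ s, ‖((ψ s : ℝ) : ℂ)‖ ≤ 1 := fun s => by
        rw [Complex.norm_real, Real.norm_of_nonneg (h01 s).1]; exact (h01 s).2
      simp only [Wfun, norm_mul, psiR, mul_zero, zero_div, Complex.ofReal_zero, Complex.exp_zero,
        norm_one, one_mul]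
      calc _ ≤ ‖omegaFn m α v x‖ * 1 * 1 := by gcongr <;> apply e
        _ = _ := by ring
    · simp
  · have : fRfun m α lam v ψ γ R x = 0 := by
      have : psiR ψ γ R x.2 = 0 := by
        apply h0
        rw [abs_div, abs_of_pos hRg, lt_div_iff₀ hRg, one_mul]
        by_contra hcon
        apply hx
        have := abs_le.1 (not_lt.1 hcon)
        constructor <;> linarith
      simp [fRfun, WRfun, this]
    simp [this]

theorem aux_int (m : ℕ) (α lam : ℝ) (hα : 0 < α) (v : (Fin m → ℝ) → ℂ) (hv : Continuous v)
    (ψ : ℝ → ℝ) (hψ : IsCutoff ψ) (γ R : ℝ) (hγ : γ < 1) (hR : 2 < R) :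
    ∫⁻ x, ‖fRfun m α lam v ψ γ R x‖ₑ ^ (2:ℝ) ≤
      ENNReal.ofReal (((2 * R) ^ (α/2)) ^ m) * (∫⁻ y, ‖v y‖ₑ ^ (2:ℝ)) *
        ENNReal.ofReal (2 * R ^ γ) := by
  have hRg : R ^ γ < R := by
    conv_rhs => rw [← Real.rpow_one R]
    exact Real.rpow_lt_rpow_of_exponent_lt (by linarith) hγ
  refine (lintegral_mono (aux_pt m α lam v ψ hψ γ R (by linarith))).trans ?_
  rw [Measure.volume_eq_prod, lintegral_prod_symm']
  · calc _ ≤ ∫⁻ z, (Set.Icc (R - R ^ γ) (R + R ^ γ)).indicator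
            (fun _ => ENNReal.ofReal (((2 * R) ^ (α/2)) ^ m) * (∫⁻ y, ‖v y‖ₑ ^ (2:ℝ))) z := by
          refine lintegral_mono fun z => ?_
          by_cases hz : z ∈ Set.Icc (R - R ^ γ) (R + R ^ γ)
          · have hz0 : 0 < z := by linarith [hz.1]
            have hz2 : z ≤ 2 * R := by linarith [hz.2]
            simp only [Set.indicator_of_mem hz, Pi.one_apply, one_mul, omegaFn]
            rw [aux_scale m v hv _ (Real.rpow_pos_of_pos hz0 _)]
            gcongr
          · simp [Set.indicator_of_notMem hz]
      _ = _ := by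
          rw [lintegral_indicator_const measurableSet_Icc, Real.volume_Icc]
          congr 2; ring
  · refine Measurable.mul ?_ ?_
    · exact (measurable_one.indicator measurableSet_Icc).comp measurable_snd
    · refine Measurable.pow_const (Measurable.enorm ?_) _
      refine hv.measurable.comp ?_
      refine measurable_pi_lambda _ fun i => ?_
      fun_prop

/-- `‖f_R‖_{L²} ≤ C R^{(α(n-1)+2γ)/4}`. -/
theorem fR_L2_bound_odd (n : ℕ) (hn : 3 ≤ n) (hodd : Odd n)
    (α : ℝ) (hα1 : 1 < α) (hα2 : α < 2)
    (lam : ℝ) (v : (Fin (n-1) → ℝ) → ℂ) (hv : IsEigen (n-1) lam v)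
    (ψ : ℝ → ℝ) (hψ : IsCutoff ψ) (γ : ℝ) (hγ1 : 1/2 < γ) (hγ2 : γ < 1) :
    ∃ C : ℝ, 0 < C ∧ ∀ R : ℝ, 2 < R →
      (eLpNorm (fRfun (n-1) α lam v ψ γ R) 2 volume).toReal ≤
        C * R ^ ((α * ((n:ℝ) - 1) + 2*γ) / 4) := by
  have hm : ((n - 1 : ℕ) : ℝ) = (n:ℝ) - 1 := by
    rw [Nat.cast_sub (by omega)]; simp
  generalize n - 1 = m at *
  rw [← hm]
  have hvc : Continuous v := hv.1.continuous
  have hv2 := hv.2.2.2.1 2 (by norm_num)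
  have hK : (∫⁻ y, ‖v y‖ₑ ^ (2:ℝ)) < ⊤ := by
    have := lintegral_rpow_enorm_lt_top_of_eLpNorm_lt_top (by simp) (by simp) hv2.2
    simpa using this
  set K := ∫⁻ y, ‖v y‖ₑ ^ (2:ℝ) with hKdef
  set D : ℝ := 2 * (2 ^ (α/2)) ^ m * K.toReal + 1 with hD
  have hDpos : 0 < D := by positivity
  refine ⟨D ^ (1/2:ℝ), by positivity, fun R hR => ?_⟩
  have hR0 : 0 < R := by linarith
  refine ENNReal.toReal_le_of_le_ofReal (by positivity) ?_
  have hint := aux_int m α lam (by linarith) v hvc ψ hψ γ R hγ2 hR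
  rw [eLpNorm_eq_lintegral_rpow_enorm_toReal (by norm_num) (by norm_num)]
  simp only [ENNReal.toReal_ofNat]
  have hE : D ^ (1/2:ℝ) * R ^ ((α * (m:ℝ) + 2*γ) / 4) =
      (D * R ^ ((α * (m:ℝ) + 2*γ) / 2)) ^ (1/2:ℝ) := by
    rw [Real.mul_rpow hDpos.le (by positivity), ← Real.rpow_mul hR0.le]
    congr 2; ring
  rw [hE, ← ENNReal.ofReal_rpow_of_nonneg (by positivity) (by norm_num)]
  refine ENNReal.rpow_le_rpow (hint.trans ?_) (by norm_num)
  rw [← hKdef, ← ENNReal.ofReal_toReal hK.ne, ← ENNReal.ofReal_mul (by positivity),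
    ← ENNReal.ofReal_mul (by positivity)]
  apply ENNReal.ofReal_le_ofReal
  have hP : R ^ ((α * (m:ℝ) + 2*γ) / 2) = (R ^ (α/2)) ^ m * R ^ γ := by
    rw [← Real.rpow_natCast (R ^ (α/2)), ← Real.rpow_mul hR0.le, ← Real.rpow_add hR0]
    congr 1; ring
  rw [Real.mul_rpow (by norm_num) hR0.le, mul_pow, hP, hD]
  have : 0 ≤ (R ^ (α/2)) ^ m * R ^ γ := by positivity
  nlinarith [this]
end
end

section
/- For every q ∈ [1,∞) there exist c > 0 and R₀ > 2 such that for all R ≥ R₀, all T > 0 and all p ∈ [1,∞): ‖W_R‖_{L^p_T L^q_x} ≥ c·T^{1/p}·R^{(α(n−1)+2γ)/(2q)}. -/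
open MeasureTheory Filter

noncomputable section

theorem auxNormExp (s : ℝ) : ‖Complex.exp (Complex.I * (s : ℂ))‖ = 1 := by
  rw [mul_comm]; exact Complex.norm_exp_ofReal_mul_I s

theorem auxWRnorm (m : ℕ) (α lam : ℝ) (v : (Fin m → ℝ) → ℂ) (ψ : ℝ → ℝ) (γ R : ℝ)
    (t : ℝ) (x : (Fin m → ℝ) × ℝ) :
    ‖WRfun m α lam v ψ γ R t x‖ = if 0 < x.2 then
      ‖omegaFn m α v x‖ * |psiR ψ γ R x.2| * |ψ (euclNorm x.1 ^ 2 / x.2 ^ 2)| else 0 := by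
  unfold WRfun Wfun
  split_ifs
  · rw [norm_mul, norm_mul, norm_mul, auxNormExp, one_mul, Complex.norm_real, Complex.norm_real]
    rfl
  · simp

theorem auxMixed (m : ℕ) (α lam : ℝ) (v : (Fin m → ℝ) → ℂ) (ψ : ℝ → ℝ) (γ R p q T : ℝ)
    (hp : 1 ≤ p) (hT : 0 < T) :
    mixedNorm p q T (WRfun m α lam v ψ γ R)
      = T ^ (1/p) * LqNorm q (WRfun m α lam v ψ γ R 0) := by
  have h : ∀ t, LqNorm q (WRfun m α lam v ψ γ R t) = LqNorm q (WRfun m α lam v ψ γ R 0) := by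
    intro t
    unfold LqNorm
    congr 1
    apply eLpNorm_congr_norm_ae
    refine Eventually.of_forall fun x => ?_
    rw [auxWRnorm, auxWRnorm]
  have hK : 0 ≤ LqNorm q (WRfun m α lam v ψ γ R 0) := ENNReal.toReal_nonneg
  unfold mixedNorm
  simp only [h]
  rw [setIntegral_const, smul_eq_mul, measureReal_def, Real.volume_Ioo, sub_zero,
    ENNReal.toReal_ofReal hT.le, Real.mul_rpow hT.le (Real.rpow_nonneg hK _),
    ← Real.rpow_mul hK, mul_one_div_cancel (by linarith), Real.rpow_one]

theorem auxCoord {m : ℕ} (y : Fin m → ℝ) (i : Fin m) : |y i| ≤ euclNorm y := by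
  unfold euclNorm
  apply Real.abs_le_sqrt
  exact Finset.single_le_sum (f := fun i => y i ^ 2) (fun i _ => sq_nonneg _) (Finset.mem_univ i)

theorem auxEucl {m : ℕ} (y : Fin m → ℝ) : euclNorm y ^ 2 ≤ m * ‖y‖ ^ 2 := by
  unfold euclNorm
  rw [Real.sq_sqrt (Finset.sum_nonneg fun i _ => sq_nonneg _)]
  calc ∑ i, y i ^ 2 ≤ ∑ _i : Fin m, ‖y‖ ^ 2 := by
        apply Finset.sum_le_sum
        intro i _
        rw [← sq_abs]
        have := norm_le_pi_norm y i
        rw [Real.norm_eq_abs] at this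
        gcongr
    _ = _ := by simp

theorem auxFinite (m : ℕ) (α lam : ℝ) (hα1 : 1 < α) (v : (Fin m → ℝ) → ℂ)
    (hv : Continuous v) (ψ : ℝ → ℝ) (hψ : IsCutoff ψ) (γ R q : ℝ)
    (hR : 2 < R) (hγR : R ^ γ ≤ R / 2) :
    eLpNorm (WRfun m α lam v ψ γ R 0) (ENNReal.ofReal q) volume < ⊤ := by
  obtain ⟨-, -, h01, hout, -⟩ := hψ
  have habs : ∀ s, |ψ s| ≤ 1 := fun s => by rw [abs_of_nonneg (h01 s).1]; exact (h01 s).2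
  set L : ℝ := 2 * R / (R/2) ^ (α/2) with hL
  have hRpos : 0 < (R/2) ^ (α/2) := Real.rpow_pos_of_pos (by linarith) _
  obtain ⟨C, hC⟩ := (isCompact_closedBall (0 : Fin m → ℝ) L).exists_bound_of_continuousOn
    hv.continuousOn
  set S : Set ((Fin m → ℝ) × ℝ) := Metric.closedBall 0 (2*R) with hS
  have key : ∀ x, ‖WRfun m α lam v ψ γ R 0 x‖ ≤ S.indicator (fun _ => C) x := by
    intro x
    by_cases hpos : 0 < x.2
    swap
    · rw [auxWRnorm, if_neg hpos]
      apply Set.indicator_nonneg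
      intro _ _
      exact (norm_nonneg _).trans (hC 0 (Metric.mem_closedBall_self (by positivity)))
    have hC0 : 0 ≤ C := (norm_nonneg _).trans (hC 0 (Metric.mem_closedBall_self (by positivity)))
    rw [auxWRnorm, if_pos hpos]
    by_cases h1 : 1 < |(x.2 - R) / R ^ γ|
    · have : psiR ψ γ R x.2 = 0 := hout _ h1
      rw [this]; simp only [abs_zero, mul_zero, zero_mul]
      exact Set.indicator_nonneg (fun _ _ => hC0) _
    by_cases h2 : 1 < |euclNorm x.1 ^ 2 / x.2 ^ 2|
    · rw [hout _ h2]; simp only [abs_zero, mul_zero]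
      exact Set.indicator_nonneg (fun _ _ => hC0) _
    push Not at h1 h2
    have hRg : 0 < R ^ γ := Real.rpow_pos_of_pos (by linarith) _
    rw [abs_div, abs_of_pos hRg, div_le_one hRg, abs_le] at h1
    have hz1 : R / 2 ≤ x.2 := by linarith
    have hz2 : x.2 ≤ 2 * R := by linarith
    rw [abs_of_nonneg (by positivity), div_le_one (by positivity)] at h2
    have he : euclNorm x.1 ≤ x.2 := by
      have := sq_le_sq.1 h2
      rw [abs_of_pos hpos] at this
      exact (le_abs_self _).trans this
    have hi : ∀ i, |x.1 i| ≤ 2 * R := fun i => (auxCoord _ i).trans (he.trans hz2)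
    have hmem : x ∈ S := by
      rw [hS, mem_closedBall_zero_iff, Prod.norm_def]
      refine max_le ?_ ?_
      · exact (pi_norm_le_iff_of_nonneg (by linarith)).2 hi
      · rw [Real.norm_eq_abs, abs_of_pos hpos]; exact hz2
    rw [Set.indicator_of_mem hmem]
    have hw : ‖omegaFn m α v x‖ ≤ C := by
      apply hC
      rw [mem_closedBall_zero_iff]
      refine (pi_norm_le_iff_of_nonneg (by positivity)).2 fun i => ?_
      rw [Real.norm_eq_abs, abs_div, abs_of_pos (Real.rpow_pos_of_pos hpos _), hL]
      have : (R/2) ^ (α/2) ≤ x.2 ^ (α/2) :=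
        Real.rpow_le_rpow (by linarith) hz1 (by linarith)
      have := hi i
      gcongr
    calc _ ≤ C * 1 * 1 := by
          gcongr
          · exact habs _
          · exact habs _
      _ = C := by ring
  refine (eLpNorm_mono_real key).trans_lt ?_
  refine (eLpNorm_indicator_const_le _ _).trans_lt ?_
  refine ENNReal.mul_lt_top enorm_lt_top ?_
  apply ENNReal.rpow_lt_top_of_nonneg (by positivity)
  exact (isCompact_closedBall _ _).measure_lt_top.ne

theorem auxLocal (m : ℕ) (v : (Fin m → ℝ) → ℂ) (hv : Continuous v) (h0 : v ≠ 0) :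
    ∃ (y0 : Fin m → ℝ) (ε δ : ℝ), 0 < ε ∧ 0 < δ ∧
      ∀ (s : ℝ) (u : Fin m → ℝ), |s - 1| < δ → ‖u - y0‖ < δ → ε ≤ ‖v (s • u)‖ := by
  obtain ⟨y0, hy0⟩ := Function.ne_iff.1 h0
  have hpos : 0 < ‖v y0‖ := norm_pos_iff.2 hy0
  have hc : Continuous fun a : ℝ × (Fin m → ℝ) => ‖v (a.1 • a.2)‖ := by fun_prop
  have hev : ∀ᶠ a in nhds ((1 : ℝ), y0), ‖v y0‖ / 2 < ‖v (a.1 • a.2)‖ := by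
    apply hc.continuousAt.eventually_const_lt
    simp only [one_smul]
    linarith
  obtain ⟨δ, hδ, H⟩ := Metric.eventually_nhds_iff.1 hev
  refine ⟨y0, ‖v y0‖ / 2, δ, by linarith, hδ, fun s u hs hu => ?_⟩
  refine (@H (s, u) ?_).le
  rw [Prod.dist_eq, dist_eq_norm, dist_eq_norm]
  exact max_lt hs hu

theorem auxPoint (m : ℕ) (α lam : ℝ) (hα1 : 1 < α) (hα2 : α < 2) (v : (Fin m → ℝ) → ℂ)
    (ψ : ℝ → ℝ) (hψ : IsCutoff ψ) (γ R : ℝ) (hR : 2 < R)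
    (y0 : Fin m → ℝ) (ε δ : ℝ) (hδ : 0 < δ)
    (hloc : ∀ (s : ℝ) (u : Fin m → ℝ), |s - 1| < δ → ‖u - y0‖ < δ → ε ≤ ‖v (s • u)‖)
    (h1 : R ^ (γ - 1) < δ) (h2 : m * (‖y0‖ + δ) ^ 2 * R ^ (α - 2) < 1/2)
    (x : (Fin m → ℝ) × ℝ)
    (hx : x ∈ Metric.ball (R ^ (α/2) • y0) (R ^ (α/2) * δ) ×ˢ Set.Ioo R (R + R ^ γ / 2)) :
    ε ≤ ‖WRfun m α lam v ψ γ R 0 x‖ := by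
  obtain ⟨-, -, -, -, hin⟩ := hψ
  obtain ⟨hy, hz1, hz2⟩ := hx
  rw [Metric.mem_ball, dist_eq_norm] at hy
  have hR0 : 0 < R := by linarith
  have hz0 : 0 < x.2 := by linarith
  have hRa : 0 < R ^ (α/2) := Real.rpow_pos_of_pos hR0 _
  have hza : 0 < x.2 ^ (α/2) := Real.rpow_pos_of_pos hz0 _
  have hRg : 0 < R ^ γ := Real.rpow_pos_of_pos hR0 _
  rw [auxWRnorm, if_pos hz0]
  have e1 : psiR ψ γ R x.2 = 1 := by
    apply hin
    rw [abs_div, abs_of_pos hRg, abs_of_pos (by linarith), div_lt_iff₀ hRg]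
    linarith
  set u : Fin m → ℝ := (R ^ (α/2))⁻¹ • x.1 with hu
  have hxu : x.1 = R ^ (α/2) • u := by rw [hu, smul_inv_smul₀ hRa.ne']
  have hud : ‖u - y0‖ < δ := by
    rw [hxu, ← smul_sub, norm_smul, Real.norm_eq_abs, abs_of_pos hRa] at hy
    exact lt_of_mul_lt_mul_left hy hRa.le
  have hun : ‖u‖ ≤ ‖y0‖ + δ := by
    calc ‖u‖ = ‖y0 + (u - y0)‖ := by congr 1; abel
      _ ≤ ‖y0‖ + ‖u - y0‖ := norm_add_le _ _
      _ ≤ _ := by linarith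
  have e2 : ψ (euclNorm x.1 ^ 2 / x.2 ^ 2) = 1 := by
    apply hin
    rw [abs_of_nonneg (by positivity)]
    refine lt_of_le_of_lt ?_ h2
    have hn : ‖x.1‖ ^ 2 ≤ R ^ α * (‖y0‖ + δ) ^ 2 := by
      rw [hxu, norm_smul, Real.norm_eq_abs, abs_of_pos hRa, mul_pow, ← Real.rpow_natCast,
        ← Real.rpow_mul hR0.le]
      have : α / 2 * ((2:ℕ):ℝ) = α := by push_cast; ring
      rw [this]
      gcongr
    have hsub : R ^ (α - 2) = R ^ α / R ^ 2 := by
      rw [Real.rpow_sub hR0, Real.rpow_two]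
    calc euclNorm x.1 ^ 2 / x.2 ^ 2 ≤ (m * (R ^ α * (‖y0‖ + δ) ^ 2)) / R ^ 2 := by
          have := auxEucl x.1
          gcongr
          exact this.trans (by gcongr)
      _ = _ := by rw [hsub]; ring
  rw [e1, e2, abs_one, mul_one, mul_one]
  have hom : omegaFn m α v x = v ((R / x.2) ^ (α/2) • u) := by
    unfold omegaFn
    congr 1
    funext i
    rw [hxu, Real.div_rpow hR0.le hz0.le]
    simp only [Pi.smul_apply, smul_eq_mul]
    ring
  rw [hom]
  apply hloc _ _ _ hud
  have hq1 : R / x.2 ≤ 1 := by rw [div_le_one hz0]; exact hz1.le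
  have hq0 : 0 < R / x.2 := by positivity
  have hs1 : (R / x.2) ^ (α/2) ≤ 1 := Real.rpow_le_one hq0.le hq1 (by linarith)
  have hs2 : R / x.2 ≤ (R / x.2) ^ (α/2) := by
    have := Real.rpow_le_rpow_of_exponent_ge hq0 hq1 (show α/2 ≤ 1 by linarith)
    rwa [Real.rpow_one] at this
  have hs3 : 1 - R ^ (γ - 1) ≤ R / x.2 := by
    have hg : R ^ (γ - 1) = R ^ γ / R := by rw [Real.rpow_sub hR0, Real.rpow_one]
    have : 1 - R / x.2 = (x.2 - R) / x.2 := by field_simp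
    have h3 : (x.2 - R) / x.2 ≤ R ^ γ / R := by
      gcongr
      linarith
    rw [hg]; linarith
  rw [abs_lt]
  constructor <;> linarith

theorem auxVol (m : ℕ) (α γ R δ q : ℝ) (hR : 2 < R) (hδ : 0 < δ) (y0 : Fin m → ℝ)
    (hq : 1 ≤ q) :
    (volume (Metric.ball (R ^ (α/2) • y0) (R ^ (α/2) * δ) ×ˢ
      Set.Ioo R (R + R ^ γ / 2) : Set ((Fin m → ℝ) × ℝ))).toReal ^ (1/q)
      = ((2 * δ) ^ m / 2) ^ (1/q) * R ^ ((α * m + 2*γ) / (2*q)) := by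
  have hR0 : 0 < R := by linarith
  have hRa : 0 < R ^ (α/2) := Real.rpow_pos_of_pos hR0 _
  have hRg : 0 < R ^ γ := Real.rpow_pos_of_pos hR0 _
  rw [Measure.volume_eq_prod, Measure.prod_prod, Real.volume_pi_ball _ (by positivity),
    Real.volume_Ioo, ENNReal.toReal_mul, ENNReal.toReal_ofReal (by positivity),
    ENNReal.toReal_ofReal (by linarith), Fintype.card_fin]
  have e : (2 * (R ^ (α/2) * δ)) ^ m * (R + R ^ γ / 2 - R)
      = ((2 * δ) ^ m / 2) * R ^ (α/2*m + γ) := by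
    rw [Real.rpow_add hR0, Real.rpow_mul hR0.le, Real.rpow_natCast, mul_pow, mul_pow, mul_pow]
    ring
  rw [e, Real.mul_rpow (by positivity) (by positivity), ← Real.rpow_mul hR0.le]
  congr 2
  field_simp

/-- `‖W_R‖_{L^p_T L^q_x} ≥ c T^{1/p} R^{(α(n-1)+2γ)/(2q)}`. -/
theorem WR_lower_bound_odd (n : ℕ) (hn : 3 ≤ n) (hodd : Odd n)
    (α : ℝ) (hα1 : 1 < α) (hα2 : α < 2)
    (lam : ℝ) (v : (Fin (n-1) → ℝ) → ℂ) (hv : IsEigen (n-1) lam v)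
    (ψ : ℝ → ℝ) (hψ : IsCutoff ψ) (γ : ℝ) (hγ1 : 1/2 < γ) (hγ2 : γ < 1)
    (q : ℝ) (hq : 1 ≤ q) :
    ∃ c R₀ : ℝ, 0 < c ∧ 2 < R₀ ∧ ∀ R : ℝ, R₀ ≤ R → ∀ T : ℝ, 0 < T → ∀ p : ℝ, 1 ≤ p →
      c * T ^ (1/p) * R ^ ((α * ((n:ℝ) - 1) + 2*γ) / (2*q)) ≤
        mixedNorm p q T (WRfun (n-1) α lam v ψ γ R) := by
  obtain ⟨hcd, hv0, -, -, -⟩ := hv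
  have hvc : Continuous v := hcd.continuous
  obtain ⟨y0, ε, δ, hε, hδ, hloc⟩ := auxLocal (n-1) v hvc hv0
  have t1 : Tendsto (fun R : ℝ => R ^ (γ - 1)) atTop (nhds 0) := by
    have := tendsto_rpow_neg_atTop (show 0 < 1 - γ by linarith)
    simpa using this
  have t2 : Tendsto (fun R : ℝ => ((n-1 : ℕ) : ℝ) * (‖y0‖ + δ) ^ 2 * R ^ (α - 2)) atTop
      (nhds 0) := by
    have := (tendsto_rpow_neg_atTop (show 0 < 2 - α by linarith)).const_mul
      (((n-1 : ℕ) : ℝ) * (‖y0‖ + δ) ^ 2)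
    simpa using this
  have hev := (t1.eventually (gt_mem_nhds hδ)).and ((t1.eventually
    (gt_mem_nhds (show (0:ℝ) < 1/2 by norm_num))).and
    (t2.eventually (gt_mem_nhds (show (0:ℝ) < 1/2 by norm_num))))
  obtain ⟨R1, hR1⟩ := eventually_atTop.1 hev
  refine ⟨ε * ((2 * δ) ^ (n-1) / 2) ^ (1/q), max R1 3, by positivity,
    lt_of_lt_of_le (by norm_num) (le_max_right _ _), ?_⟩
  intro R hR T hT p hp
  obtain ⟨a1, a2, a3⟩ := hR1 R ((le_max_left _ _).trans hR)
  have hR2 : 2 < R := by linarith [(le_max_right R1 3).trans hR]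
  have hR0 : 0 < R := by linarith
  have hγR : R ^ γ ≤ R / 2 := by
    rw [Real.rpow_sub hR0, Real.rpow_one, div_lt_iff₀ hR0] at a2
    linarith
  rw [auxMixed _ _ _ _ _ _ _ _ _ _ hp hT]
  have hfin := auxFinite (n-1) α lam hα1 v hvc ψ hψ γ R q hR2 hγR
  set S : Set ((Fin (n-1) → ℝ) × ℝ) := Metric.ball (R ^ (α/2) • y0) (R ^ (α/2) * δ) ×ˢ
    Set.Ioo R (R + R ^ γ / 2) with hS
  have hSm : MeasurableSet S := measurableSet_ball.prod measurableSet_Ioo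
  have hle : eLpNorm (S.indicator fun _ => ε) (ENNReal.ofReal q) volume
      ≤ eLpNorm (WRfun (n-1) α lam v ψ γ R 0) (ENNReal.ofReal q) volume := by
    apply eLpNorm_mono
    intro x
    by_cases hx : x ∈ S
    · rw [Set.indicator_of_mem hx, Real.norm_eq_abs, abs_of_pos hε]
      exact auxPoint (n-1) α lam hα1 hα2 v ψ hψ γ R hR2 y0 ε δ hδ hloc a1 a3 x hx
    · rw [Set.indicator_of_notMem hx, norm_zero]
      exact norm_nonneg _
  have hq0 : 0 < q := by linarith
  rw [eLpNorm_indicator_const hSm (by simpa using hq0) ENNReal.ofReal_ne_top,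
    ENNReal.toReal_ofReal hq0.le] at hle
  have hle2 := ENNReal.toReal_mono hfin.ne hle
  rw [ENNReal.toReal_mul, ← ENNReal.toReal_rpow, hS, auxVol _ _ _ _ _ _ hR2 hδ y0 hq,
    toReal_enorm, Real.norm_eq_abs, abs_of_pos hε, Nat.cast_sub (by omega), Nat.cast_one] at hle2
  have hTp : 0 ≤ T ^ (1/p) := Real.rpow_nonneg hT.le _
  calc _ = T ^ (1/p) * (ε * (((2 * δ) ^ (n-1) / 2) ^ (1/q) *
        R ^ ((α * ((n:ℝ) - 1) + 2*γ) / (2*q)))) := by ring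
    _ ≤ _ := mul_le_mul_of_nonneg_left hle2 hTp
end
end
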